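/- Let χ be a tame symplectomorphism of ℝ^{2n}, s≥0, and for each ħ∈(0,1] let A^ħ:𝒮(ℝⁿ)→𝒮′(ℝⁿ) be a continuous linear operator; set h=2πħ. For i=1,2 let g_i∈𝒮(ℝⁿ) and Λ_i=α_iℤⁿ×β_iℤⁿ (α_i,β_i>0) be such that 𝒢(g_i,Λ_i)={𝒯̂(z)g_i : z∈Λ_i} is a frame for L²(ℝⁿ). If there exists C₁>0 such that for all ħ∈(0,1] and all λ,μ∈h^{1/2}Λ₁, |⟨A^ħ𝒯̂^ħ(λ)g₁^h, 𝒯̂^ħ(μ)g₁^h⟩| ≤ C₁(1+|h^{−1/2}(μ−χ(λ))|²)^{−s/2}, then there exists C₂>0 such that for all ħ∈(0,1] and all λ,μ∈h^{1/2}Λ₂, |⟨A^ħ𝒯̂^ħ(λ)g₂^h, 𝒯̂^ħ(μ)g₂^h⟩| ≤ C₂(1+|h^{−1/2}(μ−χ(λ))|²)^{−s/2}. In other words, the class FIO_ħ(χ,s) does not depend on the chosen ħ-Gabor frame. -/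

import Mathlib

noncomputable section
open MeasureTheory Filter Complex Real
open scoped ComplexConjugate BigOperators NNReal ENNReal

namespace SC

variable {n : ℕ}

abbrev Rn (n : ℕ) := Fin n → ℝ
abbrev Ph (n : ℕ) := (Fin n → ℝ) × (Fin n → ℝ)

/-- Euclidean dot product on ℝⁿ. -/
def dot (x y : Rn n) : ℝ := ∑ i, x i * y i

/-- squared Euclidean norm on ℝⁿ. -/
def sq (x : Rn n) : ℝ := ∑ i, x i ^ 2

/-- squared Euclidean norm on phase space ℝ^{2n}. -/
def sq2 (z : Ph n) : ℝ := sq z.1 + sq z.2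

/-- translation operator T_x. -/
def Tr (x : Rn n) (f : Rn n → ℂ) : Rn n → ℂ := fun t => f (t - x)

/-- modulation operator M_ξ. -/
def Mo (ξ : Rn n) (f : Rn n → ℂ) : Rn n → ℂ :=
  fun t => Complex.exp (2 * (Real.pi : ℂ) * Complex.I * ((dot ξ t : ℝ) : ℂ)) * f t

/-- dilation operator D_λ. -/
def Dil (lam : ℝ) (f : Rn n → ℂ) : Rn n → ℂ :=
  fun x => ((lam ^ ((n : ℝ) / 2) : ℝ) : ℂ) * f (lam • x)

/-- Weyl–Heisenberg operator 𝒯̂^ħ(z). -/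
def WH (hbar : ℝ) (z : Ph n) (f : Rn n → ℂ) : Rn n → ℂ :=
  fun x => Complex.exp (Complex.I * ((hbar⁻¹ * (dot z.2 x - dot z.1 z.2 / 2) : ℝ) : ℂ)) * f (x - z.1)

/-- 𝒯̂ = 𝒯̂^{1/(2π)}. -/
def T1 (z : Ph n) (f : Rn n → ℂ) : Rn n → ℂ := WH (1 / (2 * Real.pi)) z f

/-- L² inner product ⟨f,g⟩ = ∫ f ⋅ conj g. -/
def l2inner (f g : Rn n → ℂ) : ℂ := ∫ t, f t * conj (g t)

/-- ‖f‖₂². -/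
def l2normSq (f : Rn n → ℂ) : ℝ := ∫ t, ‖f t‖ ^ 2

/-- rescaled window g^h = D_{h^{-1/2}} g. -/
def gh (h : ℝ) (g : Rn n → ℂ) : Rn n → ℂ := Dil (Real.sqrt h)⁻¹ g

/-- coercion of integer lattice point. -/
def iC (k : Fin n → ℤ) : Rn n := fun i => (k i : ℝ)

/-- A and B are frame bounds for the system of atoms. -/
def FrameBounds {ι : Type} (A B : ℝ) (atom : ι → Rn n → ℂ) : Prop :=
  ∀ f : Rn n → ℂ, MemLp f 2 volume →
    ENNReal.ofReal (A * l2normSq f) ≤ ∑' i, (‖l2inner f (atom i)‖₊ : ℝ≥0∞) ^ 2 ∧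
    ∑' i, (‖l2inner f (atom i)‖₊ : ℝ≥0∞) ^ 2 ≤ ENNReal.ofReal (B * l2normSq f)

/-- the system of atoms is a frame for L²(ℝⁿ). -/
def IsFrame {ι : Type} (atom : ι → Rn n → ℂ) : Prop :=
  ∃ A B : ℝ, 0 < A ∧ A ≤ B ∧ FrameBounds A B atom

/-- Gabor atoms T_{αk} M_{βm} g, indexed by (k,m) ∈ ℤⁿ×ℤⁿ. -/
def gaborAtom (α β : ℝ) (g : Rn n → ℂ) (km : (Fin n → ℤ) × (Fin n → ℤ)) : Rn n → ℂ :=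
  Tr (α • iC km.1) (Mo (β • iC km.2) g)

/-- the standard Gaussian ψ₀. -/
def ψ₀ : Rn n → ℂ :=
  fun x => (((2 : ℝ) ^ ((n : ℝ) / 4) : ℝ) : ℂ) * Complex.exp ((-(Real.pi * sq x) : ℝ) : ℂ)




/-- tempered distributions, modeled as continuous linear functionals on the Schwartz space;
the (antilinear) pairing ⟨u,φ⟩ of the paper is `u` applied to (a Schwartz representative of)
the complex conjugate of φ. -/
abbrev Distrib (n : ℕ) := SchwartzMap (Rn n) ℂ →L[ℂ] ℂ

/-- L^p "norm" (with exponent in ℝ≥0∞, 1 ≤ p ≤ ∞) of an ℝ≥0∞-valued function. -/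
def eLpNormR {α : Type*} [MeasurableSpace α] (p : ℝ≥0∞) (μ : Measure α)
    (F : α → ℝ≥0∞) : ℝ≥0∞ :=
  if p = ∞ then essSup F μ else (∫⁻ a, F a ^ p.toReal ∂μ) ^ (1 / p.toReal)

/-- mixed L^{p,q} norm over phase space (L^p in x, then L^q in ξ). -/
def mixedNorm (p q : ℝ≥0∞) (F : Ph n → ℝ≥0∞) : ℝ≥0∞ :=
  eLpNormR q volume (fun ξ : Rn n => eLpNormR p volume (fun x : Rn n => F (x, ξ)))

/-- v is a continuous, positive, even, submultiplicative weight. -/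
def Submult (v : Ph n → ℝ) : Prop :=
  Continuous v ∧ (∀ z, 0 < v z) ∧ (∀ z, v (-z) = v z) ∧ v 0 = 1 ∧
    ∀ z w, v (z + w) ≤ v z * v w

/-- m is a continuous, positive, even, v-moderate weight. -/
def Moderate (v m : Ph n → ℝ) : Prop :=
  Continuous m ∧ (∀ z, 0 < m z) ∧ (∀ z, m (-z) = m z) ∧
    ∃ C : ℝ, 0 < C ∧ ∀ z w, m (z + w) ≤ C * v z * m w
/-- the point of the lattice Λ = αℤⁿ×βℤⁿ indexed by (j,l) ∈ ℤⁿ×ℤⁿ. -/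
def latt (α β : ℝ) (k : (Fin n → ℤ) × (Fin n → ℤ)) : Ph n := (α • iC k.1, β • iC k.2)

/-- the standard symplectic form on ℝ^{2n}. -/
def symp (z w : Ph n) : ℝ := dot z.2 w.1 - dot z.1 w.2

/-- χ is a tame symplectomorphism: a smooth bijection with smooth inverse, preserving the
standard symplectic form, with all derivatives of order ≥ 1 bounded on ℝ^{2n}. -/
def IsTameSymplecto (χ : Ph n → Ph n) : Prop :=
  ContDiff ℝ ((⊤ : ℕ∞) : WithTop ℕ∞) χ ∧
  (∃ χi : Ph n → Ph n, Function.LeftInverse χi χ ∧ Function.RightInverse χi χ ∧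
      ContDiff ℝ ((⊤ : ℕ∞) : WithTop ℕ∞) χi) ∧
  (∀ z u w : Ph n, symp (fderiv ℝ χ z u) (fderiv ℝ χ z w) = symp u w) ∧
  (∀ k : ℕ, 1 ≤ k → ∃ C : ℝ, ∀ z, ‖iteratedFDeriv ℝ k χ z‖ ≤ C)

lemma hasSum_cg {K : Type} {f g : K → ℂ} {s : ℂ} (h : HasSum f s) (e : ∀ k, f k = g k) :
    HasSum g s := by
  have e : f = g := funext e
  rw [← e]; exact h

lemma hasSum_swap {K : Type} (x : K → ℕ → ℂ) (hx : Summable (fun p : K × ℕ => x p.1 p.2))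
    (a : ℕ → ℂ) (ha : ∀ j, HasSum (fun k => x k j) (a j)) :
    HasSum a (∑' p : K × ℕ, x p.1 p.2) := by
  have h := (Equiv.prodComm ℕ K).hasSum_iff.mpr hx.hasSum
  exact h.prod_fiberwise ha

open scoped InnerProductSpace in
/-- Abstract time-frequency system. -/
structure Sys (V H K I : Type) [AddCommGroup V] [Module ℂ V] [TopologicalSpace V]
    [NormedAddCommGroup H] [InnerProductSpace ℂ H] [AddCommGroup K] [Fintype I] where
  J : V →L[ℂ] H
  J_inj : ∀ v, J v = 0 → v = 0
  T : K → V →ₗ[ℂ] V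
  D : I → V →L[ℂ] V
  ell : I → K → ℝ
  inner_T : ∀ k l a b, ‖(inner ℂ (J (T k a)) (J (T l b)) : ℂ)‖ = ‖(inner ℂ (J a) (J (T (l - k) b)) : ℂ)‖
  norm_T : ∀ k f, ‖J (T k f)‖ = ‖J f‖
  symm_D : ∀ i a b, (inner ℂ (J (D i a)) (J b) : ℂ) = inner ℂ (J a) (J (D i b))
  comm : ∀ i k f, D i (T k f) = T k (D i f) + ((ell i k : ℝ) : ℂ) • T k f
  M : ℕ
  summ : Summable (fun k => ((1 + ∑ i, |ell i k|) ^ M)⁻¹)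
  synth : ∀ (c : K → ℂ) (b : V), (∀ m : ℕ, ∃ C : ℝ, ∀ k, ‖c k‖ * (1 + ∑ i, |ell i k|) ^ m ≤ C) →
    Summable (fun k => c k • T k b)

namespace Sys

variable {V H K I : Type} [AddCommGroup V] [Module ℂ V] [TopologicalSpace V]
    [NormedAddCommGroup H] [InnerProductSpace ℂ H] [AddCommGroup K] [Fintype I]
    (X : Sys V H K I)

/-- weight -/
def w (k : K) : ℝ := 1 + ∑ i, |X.ell i k|

lemma one_le_w (k : K) : 1 ≤ X.w k := by
  unfold w
  have : 0 ≤ ∑ i, |X.ell i k| := Finset.sum_nonneg fun i _ => abs_nonneg _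
  linarith

lemma w_pos (k : K) : 0 < X.w k := lt_of_lt_of_le one_pos (X.one_le_w k)

/-- coefficient -/
def cf (b f : V) (k : K) : ℂ := inner ℂ (X.J (X.T k b)) (X.J f)

lemma ell_cf (i : I) (b f : V) (k : K) :
    ((X.ell i k : ℝ) : ℂ) * X.cf b f k = X.cf b (X.D i f) k - X.cf (X.D i b) f k := by
  have h := X.symm_D i (X.T k b) f
  rw [X.comm] at h
  unfold cf
  rw [← h, map_add, map_smul, inner_add_left, inner_smul_left, Complex.conj_ofReal]
  ring

/-- decay of order m controlled by q -/
def Dec (m : ℕ) (q : V → ℝ) : Prop :=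
  ∀ b, ∃ C : ℝ, 0 ≤ C ∧ ∀ f k, ‖X.cf b f k‖ * X.w k ^ m ≤ C * q f

lemma dec_zero : X.Dec 0 (fun f => ‖X.J f‖) := by
  intro b
  refine ⟨‖X.J b‖, norm_nonneg _, fun f k => ?_⟩
  rw [pow_zero, mul_one]
  refine (norm_inner_le_norm _ _).trans ?_
  rw [X.norm_T]

lemma dec_step {m : ℕ} {q q' : V → ℝ} (h : X.Dec m q) (h1 : ∀ f, q f ≤ q' f)
    (h2 : ∀ i f, q (X.D i f) ≤ q' f) : X.Dec (m + 1) q' := by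
  intro b
  obtain ⟨C, hC, hb⟩ := h b
  choose Ci hCi hbi using fun i => h (X.D i b)
  refine ⟨C + ∑ i, (C + Ci i), add_nonneg hC (Finset.sum_nonneg fun i _ => add_nonneg hC (hCi i)),
    fun f k => ?_⟩
  have hw : 0 ≤ X.w k ^ m := pow_nonneg (X.w_pos k).le _
  have e1 : ‖X.cf b f k‖ * X.w k ^ m ≤ C * q' f := (hb f k).trans (by gcongr; exact h1 f)
  have e2 : ∀ i, |X.ell i k| * (‖X.cf b f k‖ * X.w k ^ m) ≤ (C + Ci i) * q' f := by
    intro i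
    have h3 : |X.ell i k| * ‖X.cf b f k‖ ≤ ‖X.cf b (X.D i f) k‖ + ‖X.cf (X.D i b) f k‖ := by
      have : |X.ell i k| * ‖X.cf b f k‖ = ‖((X.ell i k : ℝ) : ℂ) * X.cf b f k‖ := by
        rw [norm_mul, Complex.norm_real, Real.norm_eq_abs]
      rw [this, X.ell_cf]
      exact norm_sub_le _ _
    calc |X.ell i k| * (‖X.cf b f k‖ * X.w k ^ m) = (|X.ell i k| * ‖X.cf b f k‖) * X.w k ^ m := by ring
      _ ≤ (‖X.cf b (X.D i f) k‖ + ‖X.cf (X.D i b) f k‖) * X.w k ^ m := by gcongr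
      _ = ‖X.cf b (X.D i f) k‖ * X.w k ^ m + ‖X.cf (X.D i b) f k‖ * X.w k ^ m := by ring
      _ ≤ C * q (X.D i f) + Ci i * q f := add_le_add (hb _ k) (hbi i f k)
      _ ≤ C * q' f + Ci i * q' f := by
          have := hCi i
          gcongr
          · exact h2 i f
          · exact h1 f
      _ = _ := by ring
  calc ‖X.cf b f k‖ * X.w k ^ (m + 1)
      = ‖X.cf b f k‖ * X.w k ^ m + ∑ i, |X.ell i k| * (‖X.cf b f k‖ * X.w k ^ m) := by
        rw [← Finset.sum_mul, pow_succ, w]; ring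
    _ ≤ C * q' f + ∑ i, (C + Ci i) * q' f := add_le_add e1 (Finset.sum_le_sum fun i _ => e2 i)
    _ = _ := by rw [← Finset.sum_mul]; ring

lemma exists_dec (m : ℕ) : ∃ q : V → ℝ, (∀ f, 0 ≤ q f) ∧ X.Dec m q := by
  induction m with
  | zero => exact ⟨_, fun f => norm_nonneg _, X.dec_zero⟩
  | succ m ih =>
    obtain ⟨q, hq, h⟩ := ih
    refine ⟨fun f => q f + ∑ i, q (X.D i f),
      fun f => add_nonneg (hq f) (Finset.sum_nonneg fun i _ => hq _), X.dec_step h ?_ ?_⟩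
    · intro f
      have : 0 ≤ ∑ i, q (X.D i f) := Finset.sum_nonneg fun i _ => hq _
      linarith
    · intro i f
      have : q (X.D i f) ≤ ∑ i, q (X.D i f) :=
        Finset.single_le_sum (f := fun i => q (X.D i f)) (fun i _ => hq _) (Finset.mem_univ i)
      have := hq f
      linarith

lemma cf_decay (b f : V) (m : ℕ) : ∃ C : ℝ, ∀ k, ‖X.cf b f k‖ * X.w k ^ m ≤ C := by
  obtain ⟨q, hq, h⟩ := X.exists_dec m
  obtain ⟨C, hC, h⟩ := h b
  exact ⟨C * q f, fun k => h f k⟩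

lemma summable_of_decay {u : K → ℝ} (hu : ∀ k, 0 ≤ u k) {C : ℝ}
    (h : ∀ k, u k * X.w k ^ X.M ≤ C) : Summable u := by
  refine Summable.of_nonneg_of_le hu (fun k => ?_) (X.summ.mul_left C)
  have := pow_pos (X.w_pos k) X.M
  change u k ≤ C * (X.w k ^ X.M)⁻¹
  rw [← div_eq_mul_inv, le_div_iff₀ this]
  exact h k

/-- frame-type operators -/
def S (a b f : V) : V := ∑' k, X.cf a f k • X.T k b

lemma hasSum_S [T2Space V] (a b f : V) : HasSum (fun k => X.cf a f k • X.T k b) (X.S a b f) :=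
  (X.synth _ b fun m => X.cf_decay a f m).hasSum

lemma D_S [T2Space V] [IsTopologicalAddGroup V] (i : I) (a b f : V) :
    X.D i (X.S a b f) = X.S a b (X.D i f) + X.S a (X.D i b) f - X.S (X.D i a) b f := by
  have h1 := (X.hasSum_S a b f).mapL (X.D i)
  have h2 := ((X.hasSum_S a b (X.D i f)).add (X.hasSum_S a (X.D i b) f)).sub
    (X.hasSum_S (X.D i a) b f)
  refine h1.unique ?_
  convert h2 using 1
  funext k
  rw [map_smul, X.comm, smul_add, smul_smul, mul_comm, X.ell_cf, sub_smul]
  abel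

lemma synth_bound (a : V) : ∃ B : ℝ, 0 ≤ B ∧ ∀ (F : Finset K) (c : K → ℂ),
    ‖X.J (∑ k ∈ F, c k • X.T k a)‖ ^ 2 ≤ B * ∑ k ∈ F, ‖c k‖ ^ 2 := by
  obtain ⟨C, hC⟩ := X.cf_decay a a X.M
  have hs : Summable (fun k => ‖X.cf a a k‖) := X.summable_of_decay (fun k => norm_nonneg _) hC
  refine ⟨∑' k, ‖X.cf a a k‖, tsum_nonneg fun k => norm_nonneg _, fun F c => ?_⟩
  set Γ := ∑' k, ‖X.cf a a k‖
  have hG : ∀ k l, ‖(inner ℂ (X.J (X.T k a)) (X.J (X.T l a)) : ℂ)‖ = ‖X.cf a a (l - k)‖ := by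
    intro k l
    rw [X.inner_T, cf, norm_inner_symm]
  have s1 : ∀ k, ∑ l ∈ F, ‖X.cf a a (l - k)‖ ≤ Γ := by
    intro k
    have h := (Equiv.subRight k).summable_iff.mpr hs
    have h' := (Equiv.subRight k).tsum_eq (fun k => ‖X.cf a a k‖)
    rw [← show _ = Γ from h']
    exact h.sum_le_tsum F (fun _ _ => norm_nonneg _)
  have s2 : ∀ l, ∑ k ∈ F, ‖X.cf a a (l - k)‖ ≤ Γ := by
    intro k
    have h := (Equiv.subLeft k).summable_iff.mpr hs
    have h' := (Equiv.subLeft k).tsum_eq (fun k => ‖X.cf a a k‖)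
    rw [← show _ = Γ from h']
    exact h.sum_le_tsum F (fun _ _ => norm_nonneg _)
  have e : ((‖X.J (∑ k ∈ F, c k • X.T k a)‖ ^ 2 : ℝ) : ℂ) =
      ∑ k ∈ F, ∑ l ∈ F, conj (c k) * (c l * inner ℂ (X.J (X.T k a)) (X.J (X.T l a))) := by
    have := inner_self_eq_norm_sq_to_K (𝕜 := ℂ) (X.J (∑ k ∈ F, c k • X.T k a))
    push_cast
    refine this.symm.trans ?_
    rw [map_sum, sum_inner]
    refine Finset.sum_congr rfl fun k _ => ?_
    rw [inner_sum]
    refine Finset.sum_congr rfl fun l _ => ?_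
    rw [map_smul, map_smul, inner_smul_left, inner_smul_right]
  calc ‖X.J (∑ k ∈ F, c k • X.T k a)‖ ^ 2
      = ‖((‖X.J (∑ k ∈ F, c k • X.T k a)‖ ^ 2 : ℝ) : ℂ)‖ := by
        rw [Complex.norm_real, Real.norm_of_nonneg (sq_nonneg _)]
    _ ≤ ∑ k ∈ F, ∑ l ∈ F, ‖c k‖ * ‖c l‖ * ‖X.cf a a (l - k)‖ := by
        rw [e]
        refine (norm_sum_le _ _).trans (Finset.sum_le_sum fun k _ => (norm_sum_le _ _).trans
          (Finset.sum_le_sum fun l _ => ?_))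
        rw [norm_mul, norm_mul, hG, RCLike.norm_conj, mul_assoc]
    _ ≤ ∑ k ∈ F, ∑ l ∈ F, (‖c k‖ ^ 2 * ‖X.cf a a (l - k)‖ / 2 + ‖c l‖ ^ 2 * ‖X.cf a a (l - k)‖ / 2) := by
        refine Finset.sum_le_sum fun k _ => Finset.sum_le_sum fun l _ => ?_
        have := two_mul_le_add_sq ‖c k‖ ‖c l‖
        have h0 := norm_nonneg (X.cf a a (l - k))
        nlinarith
    _ = (∑ k ∈ F, ‖c k‖ ^ 2 * ∑ l ∈ F, ‖X.cf a a (l - k)‖) / 2 +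
        (∑ l ∈ F, ‖c l‖ ^ 2 * ∑ k ∈ F, ‖X.cf a a (l - k)‖) / 2 := by
        simp_rw [Finset.sum_add_distrib, Finset.mul_sum, Finset.sum_div]
        congr 1
        exact Finset.sum_comm
    _ ≤ (∑ k ∈ F, ‖c k‖ ^ 2 * Γ) / 2 + (∑ l ∈ F, ‖c l‖ ^ 2 * Γ) / 2 := by
        gcongr with k _ l _
        · exact s1 k
        · exact s2 l
    _ = Γ * ∑ k ∈ F, ‖c k‖ ^ 2 := by rw [← Finset.sum_mul]; ring

lemma bessel_aux {a : V} {B : ℝ} (hB : 0 ≤ B) (h : ∀ (F : Finset K) (c : K → ℂ),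
    ‖X.J (∑ k ∈ F, c k • X.T k a)‖ ^ 2 ≤ B * ∑ k ∈ F, ‖c k‖ ^ 2) (F : Finset K) (f : V) :
    ∑ k ∈ F, ‖X.cf a f k‖ ^ 2 ≤ B * ‖X.J f‖ ^ 2 := by
  set N := ∑ k ∈ F, ‖X.cf a f k‖ ^ 2 with hN
  have hN0 : 0 ≤ N := Finset.sum_nonneg fun k _ => sq_nonneg _
  have e : (N : ℂ) = inner ℂ (X.J (∑ k ∈ F, X.cf a f k • X.T k a)) (X.J f) := by
    rw [map_sum, sum_inner, hN]
    push_cast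
    refine Finset.sum_congr rfl fun k _ => ?_
    rw [map_smul, inner_smul_left]
    change _ = conj (X.cf a f k) * X.cf a f k
    rw [Complex.conj_mul']
  have h1 : N ≤ ‖X.J (∑ k ∈ F, X.cf a f k • X.T k a)‖ * ‖X.J f‖ := by
    have : N = ‖(N : ℂ)‖ := by rw [Complex.norm_real, Real.norm_of_nonneg hN0]
    rw [this, e]
    exact norm_inner_le_norm _ _
  have h2 := h F (X.cf a f)
  have h3 : N * N ≤ (B * ‖X.J f‖ ^ 2) * N := by
    calc N * N ≤ (‖X.J (∑ k ∈ F, X.cf a f k • X.T k a)‖ * ‖X.J f‖) *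
          (‖X.J (∑ k ∈ F, X.cf a f k • X.T k a)‖ * ‖X.J f‖) := mul_self_le_mul_self hN0 h1
      _ = ‖X.J (∑ k ∈ F, X.cf a f k • X.T k a)‖ ^ 2 * ‖X.J f‖ ^ 2 := by ring
      _ ≤ (B * N) * ‖X.J f‖ ^ 2 := by gcongr
      _ = _ := by ring
  rcases hN0.eq_or_lt with h0 | h0
  · rw [← h0]; positivity
  · exact le_of_mul_le_mul_right h3 h0

lemma synth_lim [T2Space V] {a b : V} {B N : ℝ} (hB : 0 ≤ B) (h : ∀ (F : Finset K) (c : K → ℂ),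
    ‖X.J (∑ k ∈ F, c k • X.T k b)‖ ^ 2 ≤ B * ∑ k ∈ F, ‖c k‖ ^ 2) (f : V)
    (hN : ∀ F : Finset K, ∑ k ∈ F, ‖X.cf a f k‖ ^ 2 ≤ N) :
    ‖X.J (X.S a b f)‖ ^ 2 ≤ B * N := by
  have h1 : Tendsto (fun F : Finset K => X.J (∑ k ∈ F, X.cf a f k • X.T k b)) atTop
      (nhds (X.J (X.S a b f))) :=
    (X.J.continuous.tendsto _).comp (X.hasSum_S a b f)
  refine le_of_tendsto (h1.norm.pow 2) (Eventually.of_forall fun F => (h F _).trans ?_)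
  gcongr
  exact hN F

lemma S_bound [T2Space V] (a b : V) : ∃ C : ℝ, 0 ≤ C ∧ ∀ f, ‖X.J (X.S a b f)‖ ≤ C * ‖X.J f‖ := by
  obtain ⟨Ba, hBa, ha⟩ := X.synth_bound a
  obtain ⟨Bb, hBb, hb⟩ := X.synth_bound b
  refine ⟨Real.sqrt (Bb * Ba), Real.sqrt_nonneg _, fun f => ?_⟩
  have := X.synth_lim hBb hb f (fun F => X.bessel_aux hBa ha F f)
  rw [← abs_of_nonneg (norm_nonneg (X.J (X.S a b f))), ← Real.sqrt_sq_eq_abs]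
  calc √(‖X.J (X.S a b f)‖ ^ 2) ≤ √(Bb * Ba * ‖X.J f‖ ^ 2) := Real.sqrt_le_sqrt (by linarith)
    _ = _ := by rw [Real.sqrt_mul (by positivity), Real.sqrt_sq (norm_nonneg _)]

lemma contraction [T2Space V] (g : V) {A : ℝ} (hA : 0 < A)
    (hfr : ∀ f, A * ‖X.J f‖ ^ 2 ≤ ∑' k, ‖X.cf g f k‖ ^ 2) :
    ∃ B r : ℝ, 0 < B ∧ 0 ≤ r ∧ r < 1 ∧ ∀ f, ‖X.J (f - ((B⁻¹ : ℝ) : ℂ) • X.S g g f)‖ ≤ r * ‖X.J f‖ := by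
  obtain ⟨Γ, hΓ, hg⟩ := X.synth_bound g
  set B := Γ + A with hB
  have hB0 : 0 < B := by positivity
  have hAB : A / B ≤ 1 := by rw [div_le_one hB0]; linarith
  refine ⟨B, Real.sqrt (1 - A / B), hB0, Real.sqrt_nonneg _, ?_, fun f => ?_⟩
  · rw [Real.sqrt_lt' one_pos]
    have : 0 < A / B := by positivity
    linarith
  have hs : Summable (fun k => ‖X.cf g f k‖ ^ 2) :=
    summable_of_sum_le (fun k => sq_nonneg _) (fun F => X.bessel_aux hΓ hg F f)
  set N := ∑' k, ‖X.cf g f k‖ ^ 2 with hN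
  have hN0 : 0 ≤ N := tsum_nonneg fun k => sq_nonneg _
  have h1 : ‖X.J (X.S g g f)‖ ^ 2 ≤ Γ * N :=
    X.synth_lim hΓ hg f (fun F => hs.sum_le_tsum F fun _ _ => sq_nonneg _)
  have h2 : (inner ℂ (X.J f) (X.J (X.S g g f)) : ℂ) = (N : ℂ) := by
    have a1 := ((X.hasSum_S g g f).mapL X.J).mapL (innerSL ℂ (X.J f))
    have a2 : HasSum (fun k => ((‖X.cf g f k‖ ^ 2 : ℝ) : ℂ)) (N : ℂ) :=
      Complex.hasSum_ofReal.mpr hs.hasSum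
    refine a1.unique ?_
    refine hasSum_cg a2 fun k => Eq.symm ?_
    rw [map_smul, map_smul, innerSL_apply_apply, smul_eq_mul, ← inner_conj_symm]
    change X.cf g f k * conj (X.cf g f k) = _
    rw [Complex.mul_conj']
    push_cast; rfl
  have h3 : ‖X.J (f - ((B⁻¹ : ℝ) : ℂ) • X.S g g f)‖ ^ 2 =
      ‖X.J f‖ ^ 2 - 2 * (B⁻¹ * N) + B⁻¹ ^ 2 * ‖X.J (X.S g g f)‖ ^ 2 := by
    rw [map_sub, map_smul, @norm_sub_sq ℂ, inner_smul_right, h2, norm_smul, Complex.norm_real,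
      Real.norm_of_nonneg (inv_nonneg.mpr hB0.le), mul_pow, ← Complex.ofReal_mul]
    simp
  have h4 := hfr f
  have h5 : B⁻¹ ^ 2 * ‖X.J (X.S g g f)‖ ^ 2 ≤ B⁻¹ * N := by
    calc B⁻¹ ^ 2 * ‖X.J (X.S g g f)‖ ^ 2 ≤ B⁻¹ ^ 2 * (B * N) := by
          gcongr; exact h1.trans (by gcongr; linarith)
      _ = B⁻¹ * N := by field_simp
  have h6 : B⁻¹ * (A * ‖X.J f‖ ^ 2) ≤ B⁻¹ * N := by gcongr
  rw [← abs_of_nonneg (norm_nonneg (X.J (f - ((B⁻¹ : ℝ) : ℂ) • X.S g g f))), ← Real.sqrt_sq_eq_abs]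
  calc _ ≤ √((1 - A / B) * ‖X.J f‖ ^ 2) := by
        apply Real.sqrt_le_sqrt
        rw [h3]
        have : (1 - A / B) * ‖X.J f‖ ^ 2 = ‖X.J f‖ ^ 2 - B⁻¹ * (A * ‖X.J f‖ ^ 2) := by
          rw [div_eq_mul_inv]; ring
        rw [this]
        linarith
    _ = _ := by rw [Real.sqrt_mul (by linarith), Real.sqrt_sq (norm_nonneg _)]

/-- continuous seminorms as functions -/
def SN (q : V → ℝ) : Prop :=
  (∀ u v, q (u + v) ≤ q u + q v) ∧ (∀ (c : ℂ) v, q (c • v) = ‖c‖ * q v) ∧ (∀ v, 0 ≤ q v) ∧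
    Continuous q

lemma SN.sub {q : V → ℝ} (h : SN q) (u v : V) : q (u - v) ≤ q u + q v := by
  have h1 := h.1 u ((-1 : ℂ) • v)
  rw [h.2.1] at h1
  simpa [sub_eq_add_neg] using h1

lemma good_step [T2Space V] [IsTopologicalAddGroup V] (g : V) (κ : ℝ) (hκ : 0 ≤ κ) {q : V → ℝ}
    {ρ' ρ : ℝ} (hρ : ρ' < ρ) (hq : SN q)
    (hS : ∀ a b, ∃ C : ℝ, 0 ≤ C ∧ ∀ f, q (X.S a b f) ≤ C * q f)
    (hR : ∀ f, q (f - (κ : ℂ) • X.S g g f) ≤ ρ' * q f) :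
    ∃ q' : V → ℝ, SN q' ∧ (∀ a b, ∃ C : ℝ, 0 ≤ C ∧ ∀ f, q' (X.S a b f) ≤ C * q' f) ∧
      (∀ f, q' (f - (κ : ℂ) • X.S g g f) ≤ ρ * q' f) ∧ (∀ f, q f ≤ q' f) ∧
      (∀ i f, q (X.D i f) ≤ q' f) := by
  have hq0 := hq.2.2.1
  choose C1 hC1 h1 using fun i => hS g (X.D i g)
  choose C2 hC2 h2 using fun i => hS (X.D i g) g
  set C := ∑ i, κ * (C1 i + C2 i) with hC
  have hC0 : 0 ≤ C := Finset.sum_nonneg fun i _ => mul_nonneg hκ (add_nonneg (hC1 i) (hC2 i))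
  set L := 1 + C / (ρ - ρ') with hL
  have hd : 0 < ρ - ρ' := by linarith
  have hL1 : 1 ≤ L := by
    have : 0 ≤ C / (ρ - ρ') := by positivity
    linarith
  have hLC : L * ρ' + C ≤ ρ * L := by
    have : C / (ρ - ρ') * (ρ - ρ') = C := by field_simp
    nlinarith
  have hsum0 : ∀ f, 0 ≤ ∑ i, q (X.D i f) := fun f => Finset.sum_nonneg fun i _ => hq0 _
  have hqle : ∀ f, q f ≤ L * q f + ∑ i, q (X.D i f) := fun f => by
    nlinarith [hsum0 f, hq0 f]
  have hDle : ∀ i f, q (X.D i f) ≤ L * q f + ∑ i, q (X.D i f) := fun i f => by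
    have : q (X.D i f) ≤ ∑ i, q (X.D i f) :=
      Finset.single_le_sum (f := fun i => q (X.D i f)) (fun i _ => hq0 _) (Finset.mem_univ i)
    nlinarith [hq0 f]
  refine ⟨fun f => L * q f + ∑ i, q (X.D i f), ⟨?_, ?_, ?_, ?_⟩, ?_, ?_, hqle, hDle⟩
  · intro u v
    have : ∑ i, q (X.D i (u + v)) ≤ ∑ i, q (X.D i u) + ∑ i, q (X.D i v) := by
      rw [← Finset.sum_add_distrib]
      refine Finset.sum_le_sum fun i _ => ?_
      rw [map_add]
      exact hq.1 _ _
    have h := hq.1 u v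
    have : L * q (u + v) ≤ L * (q u + q v) := by gcongr
    simp only
    linarith
  · intro c v
    simp only [map_smul, hq.2.1]
    rw [← Finset.mul_sum]; ring
  · intro v
    exact (hq0 v).trans (hqle v)
  · exact (continuous_const.mul hq.2.2.2).add
      (continuous_finsetSum _ fun i _ => hq.2.2.2.comp (X.D i).continuous)
  · intro a b
    obtain ⟨Ca, hCa, ha⟩ := hS a b
    choose E1 hE1 e1 using fun i => hS a (X.D i b)
    choose E2 hE2 e2 using fun i => hS (X.D i a) b
    refine ⟨Ca + ∑ i, (Ca + E1 i + E2 i), add_nonneg hCa (Finset.sum_nonneg fun i _ =>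
      add_nonneg (add_nonneg hCa (hE1 i)) (hE2 i)), fun f => ?_⟩
    have hi : ∀ i, q (X.D i (X.S a b f)) ≤ (Ca + E1 i + E2 i) * (L * q f + ∑ i, q (X.D i f)) := by
      intro i
      rw [X.D_S]
      calc q (X.S a b (X.D i f) + X.S a (X.D i b) f - X.S (X.D i a) b f)
          ≤ q (X.S a b (X.D i f)) + q (X.S a (X.D i b) f) + q (X.S (X.D i a) b f) :=
            (hq.sub _ _).trans (by gcongr; exact hq.1 _ _)
        _ ≤ Ca * q (X.D i f) + E1 i * q f + E2 i * q f := by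
            gcongr
            · exact ha _
            · exact e1 i f
            · exact e2 i f
        _ ≤ Ca * (L * q f + ∑ i, q (X.D i f)) + E1 i * (L * q f + ∑ i, q (X.D i f)) +
            E2 i * (L * q f + ∑ i, q (X.D i f)) := by
            have := hE1 i
            have := hE2 i
            gcongr
            · exact hDle i f
            · exact hqle f
            · exact hqle f
        _ = _ := by ring
    have h0 : L * q (X.S a b f) ≤ Ca * (L * q f + ∑ i, q (X.D i f)) := by
      calc L * q (X.S a b f) ≤ L * (Ca * q f) := by gcongr; exact ha f
        _ = Ca * (L * q f) := by ring
        _ ≤ _ := by gcongr; linarith [hsum0 f]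
    calc _ ≤ Ca * (L * q f + ∑ i, q (X.D i f)) +
          ∑ i, (Ca + E1 i + E2 i) * (L * q f + ∑ i, q (X.D i f)) :=
          add_le_add h0 (Finset.sum_le_sum fun i _ => hi i)
      _ = _ := by rw [← Finset.sum_mul]; ring
  · intro f
    have hi : ∀ i, q (X.D i (f - (κ : ℂ) • X.S g g f)) ≤
        ρ' * q (X.D i f) + κ * (C1 i + C2 i) * q f := by
      intro i
      have e : X.D i (f - (κ : ℂ) • X.S g g f) = (X.D i f - (κ : ℂ) • X.S g g (X.D i f)) -
          (κ : ℂ) • (X.S g (X.D i g) f - X.S (X.D i g) g f) := by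
        rw [map_sub, map_smul, X.D_S]
        simp only [smul_add, smul_sub]
        abel
      rw [e]
      refine (hq.sub _ _).trans ?_
      rw [hq.2.1, Complex.norm_real, Real.norm_of_nonneg hκ, mul_assoc]
      gcongr
      · exact hR _
      · refine (hq.sub _ _).trans ?_
        rw [add_mul]
        exact add_le_add (h1 i f) (h2 i f)
    have h0 : L * q (f - (κ : ℂ) • X.S g g f) ≤ L * (ρ' * q f) := by gcongr; exact hR f
    calc _ ≤ L * (ρ' * q f) + ∑ i, (ρ' * q (X.D i f) + κ * (C1 i + C2 i) * q f) :=
          add_le_add h0 (Finset.sum_le_sum fun i _ => hi i)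
      _ = (L * ρ' + C) * q f + ρ' * ∑ i, q (X.D i f) := by
          rw [Finset.sum_add_distrib, ← Finset.mul_sum, ← Finset.sum_mul]; ring
      _ ≤ (ρ * L) * q f + ρ * ∑ i, q (X.D i f) := by
          have := hq0 f
          have := hsum0 f
          gcongr
      _ = _ := by ring

lemma exists_good [T2Space V] [IsTopologicalAddGroup V] (g : V) (κ : ℝ) (hκ : 0 ≤ κ) {r : ℝ}
    (hR : ∀ f, ‖X.J (f - (κ : ℂ) • X.S g g f)‖ ≤ r * ‖X.J f‖) (m : ℕ) :
    ∀ ρ, r < ρ → ∃ q : V → ℝ, SN q ∧ (∀ a b, ∃ C : ℝ, 0 ≤ C ∧ ∀ f, q (X.S a b f) ≤ C * q f) ∧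
      (∀ f, q (f - (κ : ℂ) • X.S g g f) ≤ ρ * q f) ∧ X.Dec m q := by
  induction m with
  | zero =>
    intro ρ hρ
    refine ⟨fun f => ‖X.J f‖, ⟨fun u v => ?_, fun c v => ?_, fun v => norm_nonneg _,
      X.J.continuous.norm⟩, X.S_bound, fun f => (hR f).trans (by gcongr), X.dec_zero⟩
    · simp only [map_add]; exact norm_add_le _ _
    · simp only [map_smul]; exact norm_smul _ _
  | succ m ih =>
    intro ρ hρ
    obtain ⟨q, hq, hS, hq', hd⟩ := ih ((r + ρ) / 2) (by linarith)
    obtain ⟨q', h1, h2, h3, h4, h5⟩ := X.good_step g κ hκ (show (r + ρ) / 2 < ρ by linarith) hq hS hq'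
    exact ⟨q', h1, h2, h3, X.dec_step hd h4 h5⟩

/-- Neumann iteration -/
def it (g : V) (κ : ℝ) (f : V) : ℕ → V
  | 0 => f
  | j + 1 => it g κ f j - (κ : ℂ) • X.S g g (it g κ f j)

lemma it_bound {q : V → ℝ} {g : V} {κ ρ : ℝ} (hρ : 0 ≤ ρ)
    (hR : ∀ f, q (f - (κ : ℂ) • X.S g g f) ≤ ρ * q f) (f : V) (j : ℕ) :
    q (X.it g κ f j) ≤ ρ ^ j * q f := by
  induction j with
  | zero => simp [it]
  | succ j ih =>
    calc q (X.it g κ f (j + 1)) ≤ ρ * q (X.it g κ f j) := hR _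
      _ ≤ ρ * (ρ ^ j * q f) := by gcongr
      _ = _ := by ring

set_option maxHeartbeats 1000000 in
theorem expansion [T2Space V] [IsTopologicalAddGroup V] (g : V) {A : ℝ} (hA : 0 < A)
    (hfr : ∀ f, A * ‖X.J f‖ ^ 2 ≤ ∑' k, ‖X.cf g f k‖ ^ 2) :
    ∃ c : V → K → ℂ, (∀ f, HasSum (fun k => c f k • X.T k g) f) ∧
      ∀ m : ℕ, ∃ q : V → ℝ, SN q ∧ ∀ f k, ‖c f k‖ * X.w k ^ m ≤ q f := by
  obtain ⟨B, r, hB, hr0, hr1, hR⟩ := X.contraction g hA hfr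
  set ρ := (r + 1) / 2 with hρ
  have hρ0 : 0 ≤ ρ := by linarith
  have hρ1 : ρ < 1 := by linarith
  have hrρ : r < ρ := by linarith
  have hB' : 0 ≤ B⁻¹ := by positivity
  have hgeo := summable_geometric_of_lt_one hρ0 hρ1
  -- coefficient bounds along the iteration
  have key : ∀ m : ℕ, ∃ q : V → ℝ, SN q ∧ ∃ C : ℝ, 0 ≤ C ∧ ∀ f k j,
      ‖X.cf g (X.it g B⁻¹ f j) k‖ * X.w k ^ m ≤ C * (ρ ^ j * q f) := by
    intro m
    obtain ⟨q, hq, _, hq', hd⟩ := X.exists_good g B⁻¹ hB' hR m ρ hrρ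
    obtain ⟨C, hC, hd⟩ := hd g
    refine ⟨q, hq, C, hC, fun f k j => (hd _ k).trans ?_⟩
    gcongr
    exact X.it_bound hρ0 hq' f j
  have hsumj : ∀ f k, Summable (fun j => ‖X.cf g (X.it g B⁻¹ f j) k‖) := by
    intro f k
    obtain ⟨q, hq, C, hC, h⟩ := key 0
    refine Summable.of_nonneg_of_le (fun j => norm_nonneg _) (fun j => ?_)
      ((hgeo.mul_right (q f)).mul_left C)
    simpa using h f k j
  set c : V → K → ℂ := fun f k => ((B⁻¹ : ℝ) : ℂ) * ∑' j, X.cf g (X.it g B⁻¹ f j) k with hc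
  have hdec : ∀ m : ℕ, ∃ q : V → ℝ, SN q ∧ ∀ f k, ‖c f k‖ * X.w k ^ m ≤ q f := by
    intro m
    obtain ⟨q, hq, C, hC, h⟩ := key m
    set E := B⁻¹ * (C * ∑' j, ρ ^ j) with hE
    have hE0 : 0 ≤ E := mul_nonneg hB' (mul_nonneg hC (tsum_nonneg fun j => by positivity))
    refine ⟨fun f => E * q f, ⟨fun u v => ?_, fun a v => ?_, fun v => ?_, ?_⟩, fun f k => ?_⟩
    · simp only
      rw [← mul_add]
      gcongr
      exact hq.1 u v
    · simp only
      rw [hq.2.1]; ring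
    · exact mul_nonneg hE0 (hq.2.2.1 v)
    · exact continuous_const.mul hq.2.2.2
    · have hw := pow_pos (X.w_pos k) m
      rw [hc]
      simp only
      rw [norm_mul, Complex.norm_real, Real.norm_of_nonneg hB']
      calc B⁻¹ * ‖∑' j, X.cf g (X.it g B⁻¹ f j) k‖ * X.w k ^ m
          ≤ B⁻¹ * (∑' j, ‖X.cf g (X.it g B⁻¹ f j) k‖) * X.w k ^ m := by
            gcongr
            exact norm_tsum_le_tsum_norm (hsumj f k)
        _ = B⁻¹ * (∑' j, ‖X.cf g (X.it g B⁻¹ f j) k‖ * X.w k ^ m) := by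
            rw [tsum_mul_right]; ring
        _ ≤ B⁻¹ * (∑' j, C * (ρ ^ j * q f)) := by
            exact mul_le_mul_of_nonneg_left (Summable.tsum_le_tsum (fun j => h f k j)
              ((hsumj f k).mul_right _) ((hgeo.mul_right (q f)).mul_left C)) hB'
        _ = E * q f := by
            rw [tsum_mul_left, tsum_mul_right, hE]; ring
  refine ⟨c, fun f => ?_, hdec⟩
  have hsyn : Summable (fun k => c f k • X.T k g) := by
    refine X.synth _ g fun m => ?_
    obtain ⟨q, _, h⟩ := hdec m
    exact ⟨q f, fun k => h f k⟩
  set F := ∑' k, c f k • X.T k g with hF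
  have hFs : HasSum (fun k => c f k • X.T k g) F := hsyn.hasSum
  suffices hFf : F = f by rw [hFf] at hFs; exact hFs
  have weak : ∀ h : V, (inner ℂ (X.J h) (X.J F) : ℂ) = inner ℂ (X.J h) (X.J f) := by
    intro h
    obtain ⟨q, hq, C, hC, hk⟩ := key X.M
    have hxs : Summable (fun p : K × ℕ =>
        X.cf g (X.it g B⁻¹ f p.2) p.1 * (inner ℂ (X.J h) (X.J (X.T p.1 g)) : ℂ)) := by
      have hb : Summable (fun p : K × ℕ => (X.w p.1 ^ X.M)⁻¹ * ρ ^ p.2) :=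
        Summable.mul_of_nonneg X.summ hgeo (fun k => inv_nonneg.mpr (pow_nonneg (X.w_pos k).le _))
          (fun j => pow_nonneg hρ0 j)
      refine Summable.of_norm_bounded (hb.mul_left (C * q f * (‖X.J h‖ * ‖X.J g‖))) fun p => ?_
      have h1 := hk f p.1 p.2
      have hw := pow_pos (X.w_pos p.1) X.M
      rw [← le_div_iff₀ hw] at h1
      have h2 : ‖(inner ℂ (X.J h) (X.J (X.T p.1 g)) : ℂ)‖ ≤ ‖X.J h‖ * ‖X.J g‖ := by
        refine (norm_inner_le_norm _ _).trans ?_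
        rw [X.norm_T]
      rw [norm_mul]
      calc _ ≤ (C * (ρ ^ p.2 * q f) / X.w p.1 ^ X.M) * (‖X.J h‖ * ‖X.J g‖) := by
            have := hq.2.2.1 f
            gcongr
        _ = _ := by rw [div_eq_mul_inv]; ring
    have hS1 : ∀ j, HasSum (fun k => X.cf g (X.it g B⁻¹ f j) k * (inner ℂ (X.J h) (X.J (X.T k g)) : ℂ))
        (inner ℂ (X.J h) (X.J (X.S g g (X.it g B⁻¹ f j)))) := by
      intro j
      have a1 := ((X.hasSum_S g g (X.it g B⁻¹ f j)).mapL X.J).mapL (innerSL ℂ (X.J h))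
      refine hasSum_cg a1 fun k => ?_
      rw [map_smul, map_smul, innerSL_apply_apply, smul_eq_mul]
    have hFS : HasSum (fun k => c f k * (inner ℂ (X.J h) (X.J (X.T k g)) : ℂ))
        (inner ℂ (X.J h) (X.J F)) := by
      have a1 := (hFs.mapL X.J).mapL (innerSL ℂ (X.J h))
      refine hasSum_cg a1 fun k => ?_
      rw [map_smul, map_smul, innerSL_apply_apply, smul_eq_mul]
    have hj : HasSum (fun j => (inner ℂ (X.J h) (X.J (X.S g g (X.it g B⁻¹ f j))) : ℂ))
        (∑' p : K × ℕ, X.cf g (X.it g B⁻¹ f p.2) p.1 * (inner ℂ (X.J h) (X.J (X.T p.1 g)) : ℂ)) := by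
      exact hasSum_swap (fun k j => X.cf g (X.it g B⁻¹ f j) k *
        (inner ℂ (X.J h) (X.J (X.T k g)) : ℂ)) hxs _ hS1
    have hk2 : HasSum (fun k => (∑' j, X.cf g (X.it g B⁻¹ f j) k) * (inner ℂ (X.J h) (X.J (X.T k g)) : ℂ))
        (∑' p : K × ℕ, X.cf g (X.it g B⁻¹ f p.2) p.1 * (inner ℂ (X.J h) (X.J (X.T p.1 g)) : ℂ)) := by
      refine hxs.hasSum.prod_fiberwise fun k => ?_
      exact ((hsumj f k).of_norm.hasSum).mul_right _
    have hFe : (inner ℂ (X.J h) (X.J F) : ℂ) = ((B⁻¹ : ℝ) : ℂ) *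
        (∑' p : K × ℕ, X.cf g (X.it g B⁻¹ f p.2) p.1 * (inner ℂ (X.J h) (X.J (X.T p.1 g)) : ℂ)) := by
      refine hFS.unique ?_
      refine hasSum_cg (hk2.mul_left ((B⁻¹ : ℝ) : ℂ)) fun k => ?_
      rw [hc]; ring
    rw [hFe]
    have ht := (hj.mul_left ((B⁻¹ : ℝ) : ℂ)).tendsto_sum_nat
    refine tendsto_nhds_unique ht ?_
    have hpart : ∀ n, ∑ j ∈ Finset.range n, ((B⁻¹ : ℝ) : ℂ) *
        (inner ℂ (X.J h) (X.J (X.S g g (X.it g B⁻¹ f j))) : ℂ) =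
        inner ℂ (X.J h) (X.J f) - inner ℂ (X.J h) (X.J (X.it g B⁻¹ f n)) := by
      intro n
      induction n with
      | zero => simp [it]
      | succ n ih =>
        rw [Finset.sum_range_succ, ih]
        conv_rhs => rw [it, map_sub, map_smul, inner_sub_right, inner_smul_right]
        ring
    simp_rw [hpart]
    have hz : Tendsto (fun n => (inner ℂ (X.J h) (X.J (X.it g B⁻¹ f n)) : ℂ)) atTop (nhds 0) := by
      have hrt := (tendsto_pow_atTop_nhds_zero_of_lt_one hr0 hr1).const_mul (‖X.J h‖ * ‖X.J f‖)
      rw [mul_zero] at hrt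
      refine squeeze_zero_norm (fun n => ?_) hrt
      refine (norm_inner_le_norm _ _).trans ?_
      have := X.it_bound (q := fun f => ‖X.J f‖) hr0 hR f n
      calc _ ≤ ‖X.J h‖ * (r ^ n * ‖X.J f‖) := by gcongr
        _ = _ := by ring
    simpa using hz.const_sub (inner ℂ (X.J h) (X.J f) : ℂ)
  have h0 : X.J (F - f) = 0 := by
    have := weak (F - f)
    rw [← sub_eq_zero, ← inner_sub_right, ← map_sub] at this
    exact inner_self_eq_zero.mp this
  exact sub_eq_zero.mp (X.J_inj _ h0)

end Sys

/-- the character -/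
def ex (t : ℝ) : ℂ := Complex.exp (Complex.I * (t : ℂ))

lemma norm_ex (t : ℝ) : ‖ex t‖ = 1 := by
  rw [ex, mul_comm]; exact Complex.norm_exp_ofReal_mul_I t

lemma ex_add (s t : ℝ) : ex (s + t) = ex s * ex t := by
  simp only [ex]; rw [← Complex.exp_add]; congr 1; push_cast; ring

lemma ex_contDiff : ContDiff ℝ ((⊤ : ℕ∞) : WithTop ℕ∞) ex := by
  unfold ex
  exact ContDiff.cexp (contDiff_const.mul Complex.ofRealCLM.contDiff)

lemma ex_hasDerivAt (t : ℝ) : HasDerivAt ex (Complex.I * ex t) t := by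
  have h : HasDerivAt (fun t : ℝ => Complex.I * (t : ℂ)) (Complex.I * 1) t :=
    (Complex.ofRealCLM.hasDerivAt (x := t)).const_mul Complex.I
  have := h.cexp
  rw [mul_one, mul_comm] at this
  exact this

lemma iteratedDeriv_ex (k : ℕ) : iteratedDeriv k ex = fun t => Complex.I ^ k * ex t := by
  induction k with
  | zero => simp
  | succ k ih =>
    rw [iteratedDeriv_succ, ih]
    funext t
    have := ((ex_hasDerivAt t).const_mul (Complex.I ^ k)).deriv
    rw [this]; ring

lemma norm_iteratedFDeriv_ex (k : ℕ) (t : ℝ) : ‖iteratedFDeriv ℝ k ex t‖ = 1 := by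
  rw [norm_iteratedFDeriv_eq_norm_iteratedDeriv, iteratedDeriv_ex]
  simp [norm_ex]

lemma ex_tg : Function.HasTemperateGrowth ex := by
  refine ⟨ex_contDiff, fun k => ⟨0, 1, fun x => ?_⟩⟩
  rw [norm_iteratedFDeriv_ex]; simp

/-- dot product as a continuous linear map -/
def dotL (ξ : Rn n) : Rn n →L[ℝ] ℝ := ∑ i, ξ i • ContinuousLinearMap.proj i

lemma dotL_apply (ξ x : Rn n) : dotL ξ x = dot ξ x := by
  simp [dotL, dot]

lemma norm_dotL_le (ξ : Rn n) : ‖dotL ξ‖ ≤ n * ‖ξ‖ := by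
  refine (norm_sum_le _ _).trans ?_
  calc _ ≤ ∑ i : Fin n, ‖ξ‖ := by
        refine Finset.sum_le_sum fun i _ => ?_
        rw [norm_smul]
        have h1 : ‖(ContinuousLinearMap.proj i : Rn n →L[ℝ] ℝ)‖ ≤ 1 := by
          refine ContinuousLinearMap.opNorm_le_bound _ zero_le_one fun x => ?_
          rw [one_mul]; exact norm_le_pi_norm x i
        calc _ ≤ ‖ξ‖ * 1 := by gcongr; exact norm_le_pi_norm ξ i
          _ = _ := mul_one _
    _ = _ := by simp

/-- the exponential factor of the Weyl-Heisenberg operator -/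
def chr (z : Ph n) (x : Rn n) : ℂ := ex ((1 / (2 * Real.pi))⁻¹ * (dot z.2 x - dot z.1 z.2 / 2))

lemma chr_eq (z : Ph n) : chr z = fun x => ex (-(2 * Real.pi * (dot z.1 z.2 / 2))) •
    (ex ∘ ((2 * Real.pi) • dotL z.2)) x := by
  funext x
  simp only [chr, Function.comp, smul_eq_mul]
  rw [← ex_add]
  congr 1
  simp [dotL_apply]
  ring

lemma chr_tg (z : Ph n) : Function.HasTemperateGrowth (chr z) := by
  rw [chr_eq]
  have h1 : Function.HasTemperateGrowth (ex ∘ ((2 * Real.pi) • dotL z.2)) :=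
    ex_tg.comp (ContinuousLinearMap.hasTemperateGrowth ((2 * Real.pi) • dotL z.2))
  have h2 : Function.HasTemperateGrowth
      (fun _ : Rn n => ex (-(2 * Real.pi * (dot z.1 z.2 / 2)))) := Function.HasTemperateGrowth.const _
  exact h2.mul h1

lemma chr_bound (z : Ph n) (k : ℕ) (x : Rn n) :
    ‖iteratedFDeriv ℝ k (chr z) x‖ ≤ (2 * Real.pi * n) ^ k * (1 + ‖z‖) ^ k := by
  rw [chr_eq]
  have hc : ContDiff ℝ ((⊤ : ℕ∞) : WithTop ℕ∞) (ex ∘ ((2 * Real.pi) • dotL z.2)) :=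
    ex_contDiff.comp (ContinuousLinearMap.contDiff _)
  rw [iteratedFDeriv_const_smul_apply' (hc.contDiffAt.of_le (by exact_mod_cast le_top)), norm_smul, norm_ex, one_mul,
    ContinuousLinearMap.iteratedFDeriv_comp_right _ ex_contDiff _ (by exact_mod_cast le_top)]
  refine (ContinuousMultilinearMap.norm_compContinuousLinearMap_le _ _).trans ?_
  rw [norm_iteratedFDeriv_ex, one_mul, Finset.prod_const, Finset.card_univ, Fintype.card_fin, ← mul_pow]
  gcongr
  rw [norm_smul, Real.norm_of_nonneg (by positivity)]
  have h1 : ‖dotL z.2‖ ≤ n * (1 + ‖z‖) := by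
    refine (norm_dotL_le _).trans ?_
    gcongr
    have := norm_snd_le z
    linarith
  calc 2 * Real.pi * ‖dotL z.2‖ ≤ 2 * Real.pi * (n * (1 + ‖z‖)) := by gcongr
    _ = _ := by ring

/-- Weyl-Heisenberg operators on the Schwartz space -/
def Tz (z : Ph n) : SchwartzMap (Rn n) ℂ →L[ℂ] SchwartzMap (Rn n) ℂ :=
  (SchwartzMap.smulLeftCLM ℂ (chr z)) ∘L (SchwartzMap.compSubConstCLM ℂ z.1)

lemma Tz_apply (z : Ph n) (f : SchwartzMap (Rn n) ℂ) (x : Rn n) :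
    Tz z f x = chr z x * f (x - z.1) := by
  simp [Tz, SchwartzMap.smulLeftCLM_apply_apply (chr_tg z)]

lemma Tz_eq (z : Ph n) (f : SchwartzMap (Rn n) ℂ) : ⇑(Tz z f) = T1 z ⇑f := by
  funext x
  rw [Tz_apply]; rfl

lemma Tz_growth (f : SchwartzMap (Rn n) ℂ) (k l : ℕ) : ∃ C : ℝ, 0 ≤ C ∧ ∀ z : Ph n,
    SchwartzMap.seminorm ℂ k l (Tz z f) ≤ C * (1 + ‖z‖) ^ (k + l) := by
  set Q := 2 ^ k * ((Finset.Iic (k, l)).sup fun m => SchwartzMap.seminorm ℂ m.1 m.2) f with hQ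
  have hQ0 : 0 ≤ Q := mul_nonneg (by positivity) (apply_nonneg _ _)
  have hf : ∀ m ≤ l, ∀ y, (1 + ‖y‖) ^ k * ‖iteratedFDeriv ℝ m (⇑f) y‖ ≤ Q := fun m hm y =>
    SchwartzMap.one_add_le_sup_seminorm_apply (𝕜 := ℂ) (m := (k, l)) le_rfl hm f y
  refine ⟨∑ i ∈ Finset.range (l + 1), (l.choose i : ℝ) * (2 * Real.pi * n) ^ i * Q,
    Finset.sum_nonneg fun i _ => by positivity, fun z => ?_⟩
  have hz : 0 ≤ ‖z‖ := norm_nonneg z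
  refine SchwartzMap.seminorm_le_bound ℂ k l _ (mul_nonneg (Finset.sum_nonneg fun i _ => by positivity) (by positivity)) fun x => ?_
  have e : ⇑(Tz z f) = fun x => chr z x * (fun x => f (x - z.1)) x := funext fun x => Tz_apply z f x
  rw [e]
  have hg : ContDiff ℝ ((⊤ : ℕ∞) : WithTop ℕ∞) (fun x => f (x - z.1)) :=
    f.smooth'.comp (contDiff_id.sub contDiff_const)
  have h1 := norm_iteratedFDeriv_mul_le (chr_tg z).1 hg x (n := l) (by exact_mod_cast le_top)
  calc _ ≤ ‖x‖ ^ k * _ := mul_le_mul_of_nonneg_left h1 (by positivity)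
    _ = ∑ i ∈ Finset.range (l + 1), (l.choose i : ℝ) * ‖iteratedFDeriv ℝ i (chr z) x‖ *
        (‖x‖ ^ k * ‖iteratedFDeriv ℝ (l - i) (fun x => f (x - z.1)) x‖) := by
        rw [Finset.mul_sum]; refine Finset.sum_congr rfl fun i _ => by ring
    _ ≤ ∑ i ∈ Finset.range (l + 1), (l.choose i : ℝ) * ((2 * Real.pi * n) ^ i * (1 + ‖z‖) ^ l) *
        ((1 + ‖z‖) ^ k * Q) := by
        refine Finset.sum_le_sum fun i hi => ?_
        have hil : i ≤ l := Nat.lt_succ_iff.mp (Finset.mem_range.mp hi)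
        refine mul_le_mul (mul_le_mul_of_nonneg_left ?_ (by positivity)) ?_ (by positivity)
          (by positivity)
        · refine (chr_bound z i x).trans ?_
          gcongr
          linarith
        · rw [iteratedFDeriv_comp_sub]
          have hx : ‖x‖ ≤ (1 + ‖z‖) * (1 + ‖x - z.1‖) := by
            have a1 : ‖x‖ ≤ ‖x - z.1‖ + ‖z.1‖ := by
              simpa using norm_add_le (x - z.1) z.1
            have := norm_fst_le z
            nlinarith [norm_nonneg (x - z.1)]
          calc _ ≤ ((1 + ‖z‖) * (1 + ‖x - z.1‖)) ^ k * ‖iteratedFDeriv ℝ (l - i) (⇑f) (x - z.1)‖ := by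
                gcongr
            _ = (1 + ‖z‖) ^ k * ((1 + ‖x - z.1‖) ^ k * ‖iteratedFDeriv ℝ (l - i) (⇑f) (x - z.1)‖) := by
                rw [mul_pow]; ring
            _ ≤ _ := by gcongr; exact hf _ (Nat.sub_le _ _) _
    _ = _ := by
        rw [Finset.sum_mul]
        refine Finset.sum_congr rfl fun i _ => by rw [pow_add]; ring

lemma Tz_Tz (z w : Ph n) (f : SchwartzMap (Rn n) ℂ) :
    Tz z (Tz w f) = ex (Real.pi * (dot z.2 w.1 - dot z.1 w.2)) • Tz (z + w) f := by
  ext x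
  rw [Tz_apply, Tz_apply, smul_apply, Tz_apply, smul_eq_mul, ← mul_assoc, ← mul_assoc]
  have e2 : x - z.1 - w.1 = x - (z + w).1 := by
    rw [Prod.fst_add]; abel
  rw [e2]
  congr 1
  unfold chr
  rw [← ex_add, ← ex_add]
  congr 1
  have hd1 : dot w.2 (x - z.1) = dot w.2 x - dot z.1 w.2 := by
    simp only [dot, Pi.sub_apply, mul_sub, Finset.sum_sub_distrib]
    congr 1
    exact Finset.sum_congr rfl fun i _ => mul_comm _ _
  have hd2 : dot (z + w).2 x = dot z.2 x + dot w.2 x := by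
    simp [dot, add_mul, Finset.sum_add_distrib]
  have hd3 : dot (z + w).1 (z + w).2 = dot z.1 z.2 + dot z.1 w.2 + dot w.1 z.2 + dot w.1 w.2 := by
    simp only [dot, Prod.fst_add, Prod.snd_add, Pi.add_apply]
    rw [← Finset.sum_add_distrib, ← Finset.sum_add_distrib, ← Finset.sum_add_distrib]
    exact Finset.sum_congr rfl fun i _ => by ring
  have hd4 : dot z.2 w.1 = dot w.1 z.2 := Finset.sum_congr rfl fun i _ => mul_comm _ _
  rw [hd1, hd2, hd3, hd4]
  field_simp
  ring

lemma Tz_zero (f : SchwartzMap (Rn n) ℂ) : Tz 0 f = f := by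
  ext x
  rw [Tz_apply]
  simp [chr, dot, ex]

lemma schwartz_sum_aux {ι : Type} (u : ι → SchwartzMap (Rn n) ℂ)
    (h : ∀ k l, Summable (fun i => SchwartzMap.seminorm ℂ k l (u i))) :
    ∃ F : SchwartzMap (Rn n) ℂ, (∀ x, HasSum (fun i => u i x) (F x)) ∧
      ∀ k l, SchwartzMap.seminorm ℂ k l F ≤ ∑' i, SchwartzMap.seminorm ℂ k l (u i) := by
  have hc : ∀ i, ContDiff ℝ ((⊤ : ℕ∞) : WithTop ℕ∞) (u i) := fun i => (u i).smooth'
  have hv : ∀ k : ℕ, (k : ℕ∞) ≤ (⊤ : ℕ∞) → Summable (fun i => SchwartzMap.seminorm ℂ 0 k (u i)) :=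
    fun k _ => h 0 k
  have hb : ∀ (k : ℕ) (i : ι) (x : Rn n), (k : ℕ∞) ≤ (⊤ : ℕ∞) →
      ‖iteratedFDeriv ℝ k (u i) x‖ ≤ SchwartzMap.seminorm ℂ 0 k (u i) := fun k i x _ => by
    simpa using SchwartzMap.le_seminorm ℂ 0 k (u i) x
  have hF := contDiff_tsum hc hv hb
  have hd : ∀ k l x, ‖x‖ ^ k * ‖iteratedFDeriv ℝ l (fun x => ∑' i, u i x) x‖ ≤
      ∑' i, SchwartzMap.seminorm ℂ k l (u i) := by
    intro k l x
    rw [iteratedFDeriv_tsum_apply hc hv hb (le_top)]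
    have hn : Summable (fun i => ‖iteratedFDeriv ℝ l (u i) x‖) :=
      Summable.of_nonneg_of_le (fun _ => norm_nonneg _) (fun i => hb l i x le_top) (h 0 l)
    calc _ ≤ ‖x‖ ^ k * ∑' i, ‖iteratedFDeriv ℝ l (u i) x‖ := by
          exact mul_le_mul_of_nonneg_left (norm_tsum_le_tsum_norm hn) (by positivity)
      _ = ∑' i, ‖x‖ ^ k * ‖iteratedFDeriv ℝ l (u i) x‖ := tsum_mul_left.symm
      _ ≤ _ := Summable.tsum_le_tsum (fun i => SchwartzMap.le_seminorm ℂ k l (u i) x)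
          (hn.mul_left _) (h k l)
  refine ⟨⟨fun x => ∑' i, u i x, hF, fun k l => ⟨_, hd k l⟩⟩, fun x => ?_, fun k l => ?_⟩
  · refine Summable.hasSum (Summable.of_norm_bounded (h 0 0) fun i => ?_)
    simpa using SchwartzMap.le_seminorm ℂ 0 0 (u i) x
  · exact SchwartzMap.seminorm_le_bound ℂ k l _ (tsum_nonneg fun i => apply_nonneg _ _) (hd k l)

lemma schwartz_summable {ι : Type} (u : ι → SchwartzMap (Rn n) ℂ)
    (h : ∀ k l, Summable (fun i => SchwartzMap.seminorm ℂ k l (u i))) : Summable u := by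
  obtain ⟨F, hF, -⟩ := schwartz_sum_aux u h
  refine ⟨F, ?_⟩
  unfold HasSum
  rw [(schwartz_withSeminorms ℂ (Rn n) ℂ).tendsto_nhds]
  rintro ⟨k, l⟩ ε hε
  have ht := tendsto_tsum_compl_atTop_zero (fun i => SchwartzMap.seminorm ℂ k l (u i))
  simp only [SummationFilter.unconditional_filter]
  filter_upwards [ht.eventually (gt_mem_nhds hε)] with s hs
  obtain ⟨G, hG, hGb⟩ := schwartz_sum_aux (fun i : {i // i ∉ s} => u i)
    (fun k l => (h k l).subtype _)
  have e : ∑ i ∈ s, u i - F = -G := by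
    ext x
    have h1 := (hF x).summable.sum_add_tsum_subtype_compl s
    rw [(hF x).tsum_eq, (hG x).tsum_eq] at h1
    have h2 : (∑ i ∈ s, u i) x = ∑ i ∈ s, u i x := by
      simp
    change (∑ i ∈ s, u i) x - F x = -(G x)
    rw [h2, ← h1]; ring
  rw [e]
  calc _ = SchwartzMap.seminorm ℂ k l G := map_neg_eq_map _ _
    _ ≤ _ := hGb k l
    _ < ε := hs

lemma summable_one {a : ℝ} (ha : 0 < a) : Summable (fun k : ℤ => ((1 + |a * (k : ℝ)|) ^ 2)⁻¹) := by
  have h2 : Summable (fun k : ℤ => (a ^ 2)⁻¹ * (1 / |(k : ℝ)| ^ (2 : ℝ))) :=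
    (Real.summable_abs_int_rpow (b := 2) (by norm_num)).mul_left _ |>.congr fun k => by
      rw [Real.rpow_neg (abs_nonneg _), one_div]
  have h1 : Summable (fun k : ℤ => (a ^ 2)⁻¹ * (1 / |(k : ℝ)| ^ (2 : ℝ)) + if k = 0 then 1 else 0) :=
    h2.add (summable_of_ne_finset_zero (s := {0}) fun k hk => by simpa using hk)
  refine Summable.of_nonneg_of_le (fun k => by positivity) (fun k => ?_) h1
  by_cases hk : k = 0
  · subst hk; simp
  · have hk' : 0 < |(k : ℝ)| := abs_pos.mpr (by exact_mod_cast hk)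
    simp only [hk, if_false, add_zero]
    rw [one_div, ← mul_inv]
    have e : |(k : ℝ)| ^ (2 : ℝ) = |(k : ℝ)| ^ 2 := by norm_cast
    rw [e, ← mul_pow, abs_mul, abs_of_pos ha]
    gcongr
    linarith

lemma summable_pi_aux (u : ℤ → ℝ) (hu : ∀ k, 0 ≤ u k) (h1 : Summable u) :
    Summable (fun k : Fin n → ℤ => ∏ i, u (k i)) := by
  classical
  refine summable_of_sum_le (c := (∑' k : ℤ, u k) ^ n)
    (fun k => Finset.prod_nonneg fun i _ => hu _) fun s => ?_
  let t : Fin n → Finset ℤ := fun i => s.image fun k => k i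
  calc _ ≤ ∑ k ∈ Fintype.piFinset t, ∏ i, u (k i) := by
        refine Finset.sum_le_sum_of_subset_of_nonneg ?_ fun k _ _ =>
          Finset.prod_nonneg fun i _ => hu _
        intro k hk
        rw [Fintype.mem_piFinset]
        exact fun i => Finset.mem_image_of_mem _ hk
    _ = ∏ i, ∑ k ∈ t i, u k := (Finset.prod_univ_sum t (fun _ k => u k)).symm
    _ ≤ ∏ i : Fin n, ∑' k : ℤ, u k :=
        Finset.prod_le_prod (fun i _ => Finset.sum_nonneg fun k _ => hu k) fun i _ =>
          h1.sum_le_tsum _ fun k _ => hu k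
    _ = _ := by simp

lemma summable_pi {a : ℝ} (ha : 0 < a) :
    Summable (fun k : Fin n → ℤ => ∏ i, ((1 + |a * (k i : ℝ)|) ^ 2)⁻¹) :=
  summable_pi_aux (fun k : ℤ => ((1 + |a * (k : ℝ)|) ^ 2)⁻¹) (fun k => by positivity) (summable_one ha)

/-- coordinates of lattice points -/
def ellc (α β : ℝ) : Fin n ⊕ Fin n → ((Fin n → ℤ) × (Fin n → ℤ)) → ℝ
  | Sum.inl i, k => α * (k.1 i : ℝ)
  | Sum.inr i, k => β * (k.2 i : ℝ)

/-- lattice weight -/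
def wt (α β : ℝ) (k : (Fin n → ℤ) × (Fin n → ℤ)) : ℝ := 1 + ∑ i, |ellc α β i k|

lemma ell_le_wt (α β : ℝ) (i : Fin n ⊕ Fin n) (k : (Fin n → ℤ) × (Fin n → ℤ)) :
    1 + |ellc α β i k| ≤ wt α β k := by
  unfold wt
  have := Finset.single_le_sum (f := fun i => |ellc α β i k|) (fun i _ => abs_nonneg _) (Finset.mem_univ i)
  linarith

lemma one_le_wt (α β : ℝ) (k : (Fin n → ℤ) × (Fin n → ℤ)) : 1 ≤ wt α β k := by
  unfold wt
  have : 0 ≤ ∑ i, |ellc α β i k| := Finset.sum_nonneg fun i _ => abs_nonneg _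
  linarith

lemma wt_summ {α β : ℝ} (hα : 0 < α) (hβ : 0 < β) :
    Summable (fun k : (Fin n → ℤ) × (Fin n → ℤ) => (wt α β k ^ (4 * n))⁻¹) := by
  have h := Summable.mul_of_nonneg (summable_pi (n := n) hα) (summable_pi (n := n) hβ)
    (fun k => Finset.prod_nonneg fun i _ => by positivity)
    (fun k => Finset.prod_nonneg fun i _ => by positivity)
  refine Summable.of_nonneg_of_le (fun k => ?_) (fun k => ?_) h
  · have := one_le_wt α β k
    positivity
  · have h1 := one_le_wt α β k
    rw [Finset.prod_inv_distrib, Finset.prod_inv_distrib, ← mul_inv]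
    have p1 : ∏ i, (1 + |α * (k.1 i : ℝ)|) ^ 2 ≤ (wt α β k ^ 2) ^ n := by
      calc _ ≤ ∏ i : Fin n, wt α β k ^ 2 := by
            refine Finset.prod_le_prod (fun i _ => by positivity) fun i _ => ?_
            gcongr
            exact ell_le_wt α β (Sum.inl i) k
        _ = _ := by simp
    have p2 : ∏ i, (1 + |β * (k.2 i : ℝ)|) ^ 2 ≤ (wt α β k ^ 2) ^ n := by
      calc _ ≤ ∏ i : Fin n, wt α β k ^ 2 := by
            refine Finset.prod_le_prod (fun i _ => by positivity) fun i _ => ?_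
            gcongr
            exact ell_le_wt α β (Sum.inr i) k
        _ = _ := by simp
    have p3 : 0 < ∏ i, (1 + |α * (k.1 i : ℝ)|) ^ 2 := Finset.prod_pos fun i _ => by positivity
    have p4 : 0 < ∏ i, (1 + |β * (k.2 i : ℝ)|) ^ 2 := Finset.prod_pos fun i _ => by positivity
    apply inv_anti₀ (mul_pos p3 p4)
    calc _ ≤ (wt α β k ^ 2) ^ n * (wt α β k ^ 2) ^ n := by gcongr
      _ = _ := by rw [← mul_pow, ← pow_add, ← pow_mul]

lemma norm_latt_le_wt (α β : ℝ) (k : (Fin n → ℤ) × (Fin n → ℤ)) : 1 + ‖latt α β k‖ ≤ wt α β k := by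
  have h0 := one_le_wt α β k
  have : ‖latt α β k‖ ≤ wt α β k - 1 := by
    refine norm_prod_le_iff.mpr ⟨?_, ?_⟩
    · refine (pi_norm_le_iff_of_nonneg (by linarith)).mpr fun i => ?_
      have := ell_le_wt α β (Sum.inl i) k
      change |α * (k.1 i : ℝ)| ≤ _
      simp only [ellc] at this
      linarith
    · refine (pi_norm_le_iff_of_nonneg (by linarith)).mpr fun i => ?_
      have := ell_le_wt α β (Sum.inr i) k
      change |β * (k.2 i : ℝ)| ≤ _
      simp only [ellc] at this
      linarith
  linarith

lemma latt_sub (α β : ℝ) (k l : (Fin n → ℤ) × (Fin n → ℤ)) :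
    latt α β (k - l) = latt α β k - latt α β l := by
  ext i <;> simp [latt, iC] <;> ring

lemma latt_add (α β : ℝ) (k l : (Fin n → ℤ) × (Fin n → ℤ)) :
    latt α β (k + l) = latt α β k + latt α β l := by
  ext i <;> simp [latt, iC] <;> ring

lemma summable_synth {α β : ℝ} (hα : 0 < α) (hβ : 0 < β) (c : (Fin n → ℤ) × (Fin n → ℤ) → ℂ)
    (b : SchwartzMap (Rn n) ℂ) (hc : ∀ m : ℕ, ∃ C : ℝ, ∀ k, ‖c k‖ * wt α β k ^ m ≤ C) :
    Summable (fun k => c k • Tz (latt α β k) b) := by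
  refine schwartz_summable _ fun p q => ?_
  obtain ⟨C, hC0, hC⟩ := Tz_growth b p q
  obtain ⟨E, hE⟩ := hc (p + q + 4 * n)
  refine Summable.of_nonneg_of_le (fun k => apply_nonneg _ _) (fun k => ?_)
    ((wt_summ (n := n) hα hβ).mul_left (C * E))
  have hw := one_le_wt α β k
  have hw' : 0 < wt α β k ^ (4 * n) := by positivity
  rw [map_smul_eq_mul]
  rw [← div_eq_mul_inv, le_div_iff₀ hw']
  calc _ ≤ ‖c k‖ * (C * wt α β k ^ (p + q)) * wt α β k ^ (4 * n) := by
        gcongr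
        refine (hC _).trans ?_
        gcongr
        exact norm_latt_le_wt α β k
    _ = C * (‖c k‖ * wt α β k ^ (p + q + 4 * n)) := by rw [pow_add]; ring
    _ ≤ _ := by gcongr; exact hE k

/-- embedding in L2 -/
def Jn : SchwartzMap (Rn n) ℂ →L[ℂ] Lp ℂ 2 (volume : Measure (Rn n)) :=
  SchwartzMap.toLpCLM ℂ ℂ 2 volume

lemma inner_Jn (a b : SchwartzMap (Rn n) ℂ) :
    (inner ℂ (Jn a) (Jn b) : ℂ) = ∫ x, conj (a x) * b x := by
  change (inner ℂ (a.toLp 2 volume) (b.toLp 2 volume) : ℂ) = _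
  rw [L2.inner_def]
  apply integral_congr_ae
  filter_upwards [a.coeFn_toLp 2 volume, b.coeFn_toLp 2 volume] with x h1 h2
  rw [h1, h2, RCLike.inner_apply, mul_comm]

lemma inner_Jn_l2 (a b : SchwartzMap (Rn n) ℂ) :
    (inner ℂ (Jn a) (Jn b) : ℂ) = l2inner ⇑b ⇑a := by
  rw [inner_Jn, l2inner]
  exact integral_congr_ae (Eventually.of_forall fun x => mul_comm _ _)

lemma norm_Jn_sq (a : SchwartzMap (Rn n) ℂ) : ‖Jn a‖ ^ 2 = l2normSq ⇑a := by
  have h := inner_self_eq_norm_sq_to_K (𝕜 := ℂ) (Jn a)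
  rw [inner_Jn] at h
  have e : ∀ x, conj (a x) * a x = ((‖a x‖ ^ 2 : ℝ) : ℂ) := fun x => by
    rw [Complex.conj_mul']; push_cast; rfl
  simp_rw [e] at h
  rw [integral_complex_ofReal] at h
  have h' : ((l2normSq ⇑a : ℝ) : ℂ) = ((‖Jn a‖ ^ 2 : ℝ) : ℂ) := by
    rw [l2normSq, h]; push_cast; rfl
  exact_mod_cast h'.symm

lemma chr_norm (z : Ph n) (x : Rn n) : ‖chr z x‖ = 1 := norm_ex _

lemma inner_Tz (z : Ph n) (a b : SchwartzMap (Rn n) ℂ) :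
    (inner ℂ (Jn (Tz z a)) (Jn (Tz z b)) : ℂ) = inner ℂ (Jn a) (Jn b) := by
  rw [inner_Jn, inner_Jn]
  have e : ∀ x, conj (Tz z a x) * Tz z b x = (fun y => conj (a y) * b y) (x - z.1) := by
    intro x
    have h1 : conj (chr z x) * chr z x = 1 := by
      rw [Complex.conj_mul', chr_norm]; simp
    rw [Tz_apply, Tz_apply, map_mul]
    calc _ = (conj (chr z x) * chr z x) * (conj (a (x - z.1)) * b (x - z.1)) := by ring
      _ = _ := by rw [h1, one_mul]
  simp_rw [e]
  exact integral_sub_right_eq_self (fun y => conj (a y) * b y) z.1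

lemma norm_Tz (z : Ph n) (a : SchwartzMap (Rn n) ℂ) : ‖Jn (Tz z a)‖ = ‖Jn a‖ := by
  have h : ‖Jn (Tz z a)‖ ^ 2 = ‖Jn a‖ ^ 2 := by
    rw [@norm_sq_eq_re_inner ℂ, @norm_sq_eq_re_inner ℂ, inner_Tz]
  exact (sq_eq_sq₀ (norm_nonneg _) (norm_nonneg _)).mp h

/-- position operator -/
def Xop (i : Fin n) : SchwartzMap (Rn n) ℂ →L[ℂ] SchwartzMap (Rn n) ℂ :=
  SchwartzMap.smulLeftCLM ℂ (fun x : Rn n => ((x i : ℝ) : ℂ))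

lemma coord_tg (i : Fin n) : Function.HasTemperateGrowth (fun x : Rn n => ((x i : ℝ) : ℂ)) :=
  ContinuousLinearMap.hasTemperateGrowth
    (Complex.ofRealCLM ∘L (ContinuousLinearMap.proj i : Rn n →L[ℝ] ℝ))

lemma Xop_apply (i : Fin n) (f : SchwartzMap (Rn n) ℂ) (x : Rn n) : Xop i f x = (x i : ℂ) * f x := by
  rw [Xop, SchwartzMap.smulLeftCLM_apply_apply (coord_tg i), smul_eq_mul]

/-- derivative operator -/
def dop (i : Fin n) : SchwartzMap (Rn n) ℂ →L[ℂ] SchwartzMap (Rn n) ℂ :=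
  SchwartzMap.evalCLM ℂ (Rn n) ℂ (Pi.single i 1) ∘L SchwartzMap.fderivCLM ℂ (Rn n) ℂ

lemma dop_apply (i : Fin n) (f : SchwartzMap (Rn n) ℂ) (x : Rn n) :
    dop i f x = fderiv ℝ f x (Pi.single i 1) := rfl

/-- momentum operator -/
def Pop (i : Fin n) : SchwartzMap (Rn n) ℂ →L[ℂ] SchwartzMap (Rn n) ℂ :=
  (-(Complex.I / (2 * Real.pi))) • dop i

lemma Pop_apply (i : Fin n) (f : SchwartzMap (Rn n) ℂ) (x : Rn n) :
    Pop i f x = -(Complex.I / (2 * Real.pi)) * fderiv ℝ f x (Pi.single i 1) := rfl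

/-- complex conjugation -/
def cj : SchwartzMap (Rn n) ℂ →L[ℝ] SchwartzMap (Rn n) ℂ :=
  SchwartzMap.postcompCLM (Complex.conjCLE : ℂ →L[ℝ] ℂ)

lemma cj_apply (f : SchwartzMap (Rn n) ℂ) (x : Rn n) : cj f x = conj (f x) := rfl

lemma dop_cj (i : Fin n) (f : SchwartzMap (Rn n) ℂ) (x : Rn n) :
    dop i (cj f) x = conj (dop i f x) := by
  rw [dop_apply, dop_apply]
  have h := ((Complex.conjCLE : ℂ →L[ℝ] ℂ).hasFDerivAt.comp x f.differentiableAt.hasFDerivAt)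
  have e : fderiv ℝ (⇑(cj f)) x = (Complex.conjCLE : ℂ →L[ℝ] ℂ) ∘L fderiv ℝ (⇑f) x := h.fderiv
  rw [e]; rfl

lemma symm_X (i : Fin n) (a b : SchwartzMap (Rn n) ℂ) :
    (inner ℂ (Jn (Xop i a)) (Jn b) : ℂ) = inner ℂ (Jn a) (Jn (Xop i b)) := by
  rw [inner_Jn, inner_Jn]
  refine integral_congr_ae (Eventually.of_forall fun x => ?_)
  simp only [Xop_apply, map_mul, Complex.conj_ofReal]
  ring

lemma symm_P (i : Fin n) (a b : SchwartzMap (Rn n) ℂ) :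
    (inner ℂ (Jn (Pop i a)) (Jn b) : ℂ) = inner ℂ (Jn a) (Jn (Pop i b)) := by
  have key : ∫ x, cj a x * dop i b x = -∫ x, dop i (cj a) x * b x :=
    SchwartzMap.integral_mul_lineDerivOp_right_eq_neg_left (cj a) b (Pi.single i 1)
  have h1 : (inner ℂ (Jn (dop i a)) (Jn b) : ℂ) = - inner ℂ (Jn a) (Jn (dop i b)) := by
    rw [inner_Jn, inner_Jn]
    simp_rw [dop_cj, cj_apply] at key
    rw [key, neg_neg]
  rw [Pop, smul_apply, smul_apply, map_smul, map_smul, inner_smul_left, inner_smul_right, h1]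
  have hc : conj (-(Complex.I / (2 * (Real.pi : ℂ)))) = Complex.I / (2 * (Real.pi : ℂ)) := by
    have h2 : conj (2 : ℂ) = 2 := Complex.conj_ofNat 2
    rw [map_neg, map_div₀, map_mul, Complex.conj_I, Complex.conj_ofReal, h2]
    ring
  rw [hc]; ring

lemma comm_X (i : Fin n) (z : Ph n) (f : SchwartzMap (Rn n) ℂ) :
    Xop i (Tz z f) = Tz z (Xop i f) + ((z.1 i : ℝ) : ℂ) • Tz z f := by
  ext x
  rw [Xop_apply, Tz_apply, add_apply, smul_apply, Tz_apply, Tz_apply, Xop_apply, smul_eq_mul]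
  simp only [Pi.sub_apply]
  push_cast
  ring

lemma chr_hasFDerivAt (z : Ph n) (x : Rn n) :
    HasFDerivAt (chr z) (((2 * Real.pi) • dotL z.2).smulRight (Complex.I * chr z x)) x := by
  have h1 : HasFDerivAt (fun x : Rn n => (2 * Real.pi) • dotL z.2 x - 2 * Real.pi * (dot z.1 z.2 / 2))
      ((2 * Real.pi) • dotL z.2) x :=
    (((2 * Real.pi) • dotL z.2).hasFDerivAt).sub_const _
  have h2 := (ex_hasDerivAt ((2 * Real.pi) • dotL z.2 x - 2 * Real.pi * (dot z.1 z.2 / 2))).hasFDerivAt.comp x h1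
  have e : chr z = ex ∘ (fun x : Rn n => (2 * Real.pi) • dotL z.2 x - 2 * Real.pi * (dot z.1 z.2 / 2)) := by
    funext y
    simp only [chr, Function.comp, dotL_apply, smul_eq_mul]
    congr 1
    field_simp
  rw [e]
  refine h2.congr_fderiv ?_
  ext v
  simp
  ring

lemma comm_P (i : Fin n) (z : Ph n) (f : SchwartzMap (Rn n) ℂ) :
    Pop i (Tz z f) = Tz z (Pop i f) + ((z.2 i : ℝ) : ℂ) • Tz z f := by
  ext x
  rw [add_apply, smul_apply, Tz_apply, Tz_apply, Pop_apply, Pop_apply, smul_eq_mul]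
  have e : ⇑(Tz z f) = chr z * (fun x => f (x - z.1)) := funext fun x => Tz_apply z f x
  have hf : HasFDerivAt (fun x => f (x - z.1)) (fderiv ℝ f (x - z.1)) x := by
    have h := (f.differentiableAt (x := x - z.1)).hasFDerivAt
    exact h.comp x ((hasFDerivAt_id x).sub_const z.1)
  have hm := (chr_hasFDerivAt z x).mul hf
  rw [e, hm.fderiv]
  have hd : dotL z.2 (Pi.single i 1) = z.2 i := by
    simp [dotL_apply, dot, Pi.single_apply]
  simp only [add_apply, smul_apply, ContinuousLinearMap.smulRight_apply, hd, smul_eq_mul, Complex.real_smul]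
  push_cast
  have hpi : (Real.pi : ℂ) ≠ 0 := by exact_mod_cast Real.pi_ne_zero
  field_simp
  ring_nf
  rw [Complex.I_sq]
  ring

/-- the concrete system -/
def theSys {α β : ℝ} (hα : 0 < α) (hβ : 0 < β) :
    Sys (SchwartzMap (Rn n) ℂ) (Lp ℂ 2 (volume : Measure (Rn n)))
      ((Fin n → ℤ) × (Fin n → ℤ)) (Fin n ⊕ Fin n) where
  J := Jn
  J_inj := fun v hv => by
    refine SchwartzMap.injective_toLp (F := ℂ) 2 (volume : Measure (Rn n)) ?_
    exact hv.trans (map_zero Jn).symm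
  T := fun k => (Tz (latt α β k)).toLinearMap
  D := fun i => match i with
    | Sum.inl i => Xop i
    | Sum.inr i => Pop i
  ell := ellc α β
  inner_T := fun k l a b => by
    have h := Tz_Tz (latt α β k) (latt α β (l - k)) b
    rw [← latt_add, add_sub_cancel] at h
    have h2 := inner_Tz (latt α β k) a (Tz (latt α β (l - k)) b)
    rw [h, map_smul, inner_smul_right] at h2
    change ‖(inner ℂ (Jn (Tz (latt α β k) a)) (Jn (Tz (latt α β l) b)) : ℂ)‖ =
      ‖(inner ℂ (Jn a) (Jn (Tz (latt α β (l - k)) b)) : ℂ)‖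
    rw [← h2, norm_mul, norm_ex, one_mul]
  norm_T := fun k f => norm_Tz _ f
  symm_D := fun i a b => by
    cases i with
    | inl i => exact symm_X i a b
    | inr i => exact symm_P i a b
  comm := fun i k f => by
    cases i with
    | inl i => exact comm_X i (latt α β k) f
    | inr i => exact comm_P i (latt α β k) f
  M := 4 * n
  summ := wt_summ hα hβ
  synth := fun c b h => summable_synth hα hβ c b h

theorem expand {α β : ℝ} (hα : 0 < α) (hβ : 0 < β) (g : SchwartzMap (Rn n) ℂ)
    (hframe : IsFrame (fun k => T1 (latt α β k) ⇑g)) :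
    ∃ c : SchwartzMap (Rn n) ℂ → (Fin n → ℤ) × (Fin n → ℤ) → ℂ,
      (∀ f, HasSum (fun k => c f k • Tz (latt α β k) g) f) ∧
      ∀ m : ℕ, ∃ q : SchwartzMap (Rn n) ℂ → ℝ, Sys.SN q ∧ ∀ f k, ‖c f k‖ * wt α β k ^ m ≤ q f := by
  obtain ⟨A, B, hA, hAB, hfb⟩ := hframe
  refine (theSys (n := n) hα hβ).expansion g hA fun f => ?_
  obtain ⟨h1, h2⟩ := hfb ⇑f (f.memLp 2 volume)
  have e : ∀ k, l2inner ⇑f (T1 (latt α β k) ⇑g) = (theSys hα hβ).cf g f k := by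
    intro k
    rw [← Tz_eq, ← inner_Jn_l2]; rfl
  simp_rw [e] at h1 h2
  have e2 : ∀ k, ((‖(theSys hα hβ).cf g f k‖₊ : ℝ≥0∞)) ^ 2 =
      ENNReal.ofReal (‖(theSys hα hβ).cf g f k‖ ^ 2) := by
    intro k
    rw [ENNReal.ofReal_pow (norm_nonneg _), ofReal_norm]; rfl
  simp_rw [e2] at h1 h2
  have hfin : ∑' k, ENNReal.ofReal (‖(theSys hα hβ).cf g f k‖ ^ 2) ≠ ⊤ :=
    ne_top_of_le_ne_top ENNReal.ofReal_ne_top h2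
  have hs : Summable (fun k => ‖(theSys hα hβ).cf g f k‖ ^ 2) := by
    have := ENNReal.summable_toReal hfin
    refine this.congr fun k => ?_
    rw [ENNReal.toReal_ofReal (sq_nonneg _)]
  rw [← ENNReal.ofReal_tsum_of_nonneg (fun k => sq_nonneg _) hs] at h1
  have h3 := (ENNReal.ofReal_le_ofReal_iff (tsum_nonneg fun k => sq_nonneg _)).mp h1
  rw [← norm_Jn_sq] at h3
  exact h3

lemma SN_bound {q : SchwartzMap (Rn n) ℂ → ℝ} (hq : Sys.SN q) (g : SchwartzMap (Rn n) ℂ) (R : ℝ) :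
    ∃ C : ℝ, 0 ≤ C ∧ ∀ z : Ph n, ‖z‖ ≤ R → q (Tz z g) ≤ C := by
  let Q : Seminorm ℂ (SchwartzMap (Rn n) ℂ) := Seminorm.of q hq.1 hq.2.1
  have hQ : Continuous Q := hq.2.2.2
  obtain ⟨s, C, -, h⟩ := Seminorm.bound_of_continuous (schwartz_withSeminorms ℂ (Rn n) ℂ) Q hQ
  choose E hE0 hE using Tz_growth g
  refine ⟨C * ∑ m ∈ s, E m.1 m.2 * (1 + |R|) ^ (m.1 + m.2), ?_, fun z hz => ?_⟩
  · refine mul_nonneg C.2 (Finset.sum_nonneg fun m _ => mul_nonneg (hE0 _ _) (by positivity))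
  · have h1 := h (Tz z g)
    have h2 := Seminorm.finset_sup_le_sum (schwartzSeminormFamily ℂ (Rn n) ℂ) s (Tz z g)
    have h3 : (∑ m ∈ s, schwartzSeminormFamily ℂ (Rn n) ℂ m) (Tz z g) =
        ∑ m ∈ s, schwartzSeminormFamily ℂ (Rn n) ℂ m (Tz z g) := by
      simp
    rw [h3] at h2
    change q (Tz z g) ≤ _
    refine h1.trans ?_
    change (C : ℝ) * _ ≤ _
    refine mul_le_mul_of_nonneg_left (h2.trans ?_) C.2
    refine Finset.sum_le_sum fun m _ => (hE m.1 m.2 z).trans ?_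
    refine mul_le_mul_of_nonneg_left ?_ (hE0 _ _)
    gcongr
    exact hz.trans (le_abs_self R)

/-- nearest lattice point (componentwise floor) -/
def rnd (α β : ℝ) (z : Ph n) : (Fin n → ℤ) × (Fin n → ℤ) :=
  (fun i => ⌊z.1 i / α⌋, fun i => ⌊z.2 i / β⌋)

lemma floor_aux {a : ℝ} (ha : 0 < a) (t : ℝ) : |t - a * (⌊t / a⌋ : ℝ)| ≤ a := by
  have h1 := Int.floor_le (t / a)
  have h2 := Int.lt_floor_add_one (t / a)
  rw [le_div_iff₀ ha] at h1
  rw [div_lt_iff₀ ha] at h2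
  rw [abs_le]
  constructor <;> nlinarith

lemma rnd_norm {α β : ℝ} (hα : 0 < α) (hβ : 0 < β) (z : Ph n) :
    ‖z - latt α β (rnd α β z)‖ ≤ α + β := by
  refine norm_prod_le_iff.mpr ⟨?_, ?_⟩
  · refine (pi_norm_le_iff_of_nonneg (by linarith)).mpr fun i => ?_
    have := floor_aux hα (z.1 i)
    change |z.1 i - α * (⌊z.1 i / α⌋ : ℝ)| ≤ _
    linarith
  · refine (pi_norm_le_iff_of_nonneg (by linarith)).mpr fun i => ?_
    have := floor_aux hβ (z.2 i)
    change |z.2 i - β * (⌊z.2 i / β⌋ : ℝ)| ≤ _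
    linarith

lemma ex_ne (t : ℝ) : ex t ≠ 0 := by
  intro h
  have := norm_ex t
  rw [h] at this
  simp at this

theorem gabor_exp {α β : ℝ} (hα : 0 < α) (hβ : 0 < β) (g g' : SchwartzMap (Rn n) ℂ)
    (hframe : IsFrame (fun k => T1 (latt α β k) ⇑g)) :
    ∃ a : Ph n → (Fin n → ℤ) × (Fin n → ℤ) → ℂ,
      (∀ z, HasSum (fun k => a z k • Tz (latt α β k) g) (Tz z g')) ∧
      ∀ m : ℕ, ∃ C : ℝ, 0 ≤ C ∧ ∀ z, Summable (fun k => ‖a z k‖ * (1 + ‖latt α β k - z‖) ^ m) ∧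
        ∑' k, ‖a z k‖ * (1 + ‖latt α β k - z‖) ^ m ≤ C := by
  obtain ⟨c, hc, hq⟩ := expand hα hβ g hframe
  let p : Ph n → Ph n → ℝ := fun z w => Real.pi * (dot z.2 w.1 - dot z.1 w.2)
  let k0 : Ph n → (Fin n → ℤ) × (Fin n → ℤ) := rnd α β
  let w : Ph n → Ph n := fun z => z - latt α β (k0 z)
  have hw : ∀ z, ‖w z‖ ≤ α + β := rnd_norm hα hβ
  refine ⟨fun z k => (ex (p (latt α β (k0 z)) (w z)))⁻¹ * (c (Tz (w z) g') (k - k0 z) *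
    ex (p (latt α β (k0 z)) (latt α β (k - k0 z)))), fun z => ?_, fun m => ?_⟩
  · have h1 := (hc (Tz (w z) g')).mapL (Tz (latt α β (k0 z)))
    have h2 := h1.const_smul (ex (p (latt α β (k0 z)) (w z)))⁻¹
    rw [Tz_Tz, smul_smul, inv_mul_cancel₀ (ex_ne _), one_smul, add_sub_cancel] at h2
    rw [← (Equiv.subRight (k0 z)).hasSum_iff] at h2
    refine (congrArg (fun F => HasSum F (Tz z g')) (funext fun k => ?_)).mp h2
    simp only [Function.comp, Equiv.subRight_apply, map_smul, Tz_Tz]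
    rw [← latt_add, add_sub_cancel, smul_smul, smul_smul, mul_assoc]
  · obtain ⟨q, hqS, hqb⟩ := hq (m + 4 * n)
    obtain ⟨C, hC0, hC⟩ := SN_bound hqS g' (α + β)
    suffices H : ∀ z k, ‖(ex (p (latt α β (k0 z)) (w z)))⁻¹ * (c (Tz (w z) g') (k - k0 z) *
        ex (p (latt α β (k0 z)) (latt α β (k - k0 z))))‖ * (1 + ‖latt α β k - z‖) ^ m ≤
        (1 + (α + β)) ^ m * C * (wt α β (k - k0 z) ^ (4 * n))⁻¹ by
      have hsz : ∀ z, HasSum (fun k => (1 + (α + β)) ^ m * C * (wt α β (k - k0 z) ^ (4 * n))⁻¹)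
          ((1 + (α + β)) ^ m * C * ∑' k : (Fin n → ℤ) × (Fin n → ℤ), (wt α β k ^ (4 * n))⁻¹) := by
        intro z
        have := (wt_summ (n := n) hα hβ).hasSum.mul_left ((1 + (α + β)) ^ m * C)
        rw [← (Equiv.subRight (k0 z)).hasSum_iff] at this
        exact this
      refine ⟨(1 + (α + β)) ^ m * C * ∑' k : (Fin n → ℤ) × (Fin n → ℤ), (wt α β k ^ (4 * n))⁻¹,
        ?_, fun z => ?_⟩
      · refine mul_nonneg (by positivity) (tsum_nonneg fun k => ?_)
        have := one_le_wt α β k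
        positivity
      · have hsum := Summable.of_nonneg_of_le (fun k => by positivity) (H z) (hsz z).summable
        exact ⟨hsum, (hsz z).tsum_eq ▸ hsum.tsum_le_tsum (H z) (hsz z).summable⟩
    intro z k
    have h0 := one_le_wt α β (k - k0 z)
    rw [norm_mul, norm_mul, norm_inv, norm_ex, norm_ex, inv_one, one_mul, mul_one]
    have h1 := hqb (Tz (w z) g') (k - k0 z)
    have h2 := hC (w z) (hw z)
    have h3 := norm_latt_le_wt α β (k - k0 z)
    have h4 : 1 + ‖latt α β k - z‖ ≤ (1 + (α + β)) * wt α β (k - k0 z) := by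
      have e : latt α β k - z = latt α β (k - k0 z) - w z := by
        rw [latt_sub]; simp only [w]; abel
      rw [e]
      have := norm_sub_le (latt α β (k - k0 z)) (w z)
      have := hw z
      have := norm_nonneg (latt α β (k - k0 z))
      nlinarith
    rw [← div_eq_mul_inv, le_div_iff₀ (by positivity)]
    calc _ ≤ ‖c (Tz (w z) g') (k - k0 z)‖ * ((1 + (α + β)) * wt α β (k - k0 z)) ^ m *
          wt α β (k - k0 z) ^ (4 * n) := by gcongr
      _ = (1 + (α + β)) ^ m * (‖c (Tz (w z) g') (k - k0 z)‖ * wt α β (k - k0 z) ^ (m + 4 * n)) := by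
          rw [mul_pow, pow_add]; ring
      _ ≤ _ := by gcongr; exact h1.trans h2

/-- dilation as a continuous linear map of the Schwartz space -/
def dilS (u : ℝˣ) : SchwartzMap (Rn n) ℂ →L[ℂ] SchwartzMap (Rn n) ℂ :=
  (((((u : ℝ) ^ ((n : ℝ) / 2) : ℝ) : ℂ))) •
    SchwartzMap.compCLMOfContinuousLinearEquiv ℂ
      (ContinuousLinearEquiv.smulLeft (R₁ := ℝ) (M₁ := Rn n) u)

lemma dilS_apply (u : ℝˣ) (f : SchwartzMap (Rn n) ℂ) (t : Rn n) :
    dilS u f t = ((((u : ℝ) ^ ((n : ℝ) / 2) : ℝ) : ℂ)) * f ((u : ℝ) • t) := rfl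

lemma dot_smul_left (r : ℝ) (x y : Rn n) : dot (r • x) y = r * dot x y := by
  simp only [dot, Finset.mul_sum, Pi.smul_apply, smul_eq_mul, mul_assoc]

lemma dot_smul_right (r : ℝ) (x y : Rn n) : dot x (r • y) = r * dot x y := by
  simp only [dot, Finset.mul_sum, Pi.smul_apply, smul_eq_mul]
  exact Finset.sum_congr rfl fun i _ => by ring

lemma WH_scale {hbar : ℝ} (hb : 0 < hbar) (u : ℝˣ)
    (hu : (u : ℝ) = (Real.sqrt (2 * Real.pi * hbar))⁻¹) (z : Ph n) (g : SchwartzMap (Rn n) ℂ)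
    (t : Rn n) :
    WH hbar (Real.sqrt (2 * Real.pi * hbar) • z) (gh (2 * Real.pi * hbar) ⇑g) t =
      dilS u (Tz z g) t := by
  have hpos : 0 < 2 * Real.pi * hbar := by positivity
  set r := Real.sqrt (2 * Real.pi * hbar) with hr
  have hr0 : 0 < r := Real.sqrt_pos.mpr hpos
  have hr2 : r * r = 2 * Real.pi * hbar := Real.mul_self_sqrt hpos.le
  have hbe : hbar⁻¹ = 2 * Real.pi * r⁻¹ * r⁻¹ := by
    have : 2 * Real.pi = r * r * hbar⁻¹ := by rw [hr2]; field_simp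
    rw [this]; field_simp
  rw [dilS_apply, Tz_apply, hu]
  simp only [WH, gh, Dil, chr, ex, ← hr, Prod.smul_fst, Prod.smul_snd, dot_smul_left,
    dot_smul_right, smul_sub, smul_smul]
  rw [inv_mul_cancel₀ hr0.ne', one_smul, hbe]
  have e : 2 * Real.pi * r⁻¹ * r⁻¹ * (r * dot z.2 t - r * (r * dot z.1 z.2) / 2) =
      (1 / (2 * Real.pi))⁻¹ * (r⁻¹ * dot z.2 t - dot z.1 z.2 / 2) := by
    rw [one_div, inv_inv]; field_simp
  rw [e]; ring

lemma norm_le_of_hasSum {ι : Type*} {f : ι → ℂ} {x : ℂ} {b : ι → ℝ} {M C : ℝ} (hf : HasSum f x)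
    (hM : 0 ≤ M) (hb : Summable b) (hC : ∑' i, b i ≤ C) (h : ∀ i, ‖f i‖ ≤ M * b i) :
    ‖x‖ ≤ M * C := by
  have h1 := tsum_of_norm_bounded (hb.hasSum.mul_left M) h
  rw [hf.tsum_eq] at h1
  exact h1.trans (mul_le_mul_of_nonneg_left hC hM)

lemma sq_nonneg' (x : Rn n) : 0 ≤ sq x := Finset.sum_nonneg fun i _ => sq_nonneg (x i)

lemma sq2_nonneg (z : Ph n) : 0 ≤ sq2 z := add_nonneg (sq_nonneg' _) (sq_nonneg' _)

lemma sq_add_le (x y : Rn n) : sq (x + y) ≤ 2 * sq x + 2 * sq y := by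
  simp only [sq, Finset.mul_sum, ← Finset.sum_add_distrib, Pi.add_apply]
  exact Finset.sum_le_sum fun i _ => by nlinarith [sq_nonneg (x i - y i)]

lemma sq2_add_le (x y : Ph n) : sq2 (x + y) ≤ 2 * sq2 x + 2 * sq2 y := by
  have := sq_add_le x.1 y.1
  have := sq_add_le x.2 y.2
  simp only [sq2, Prod.fst_add, Prod.snd_add]
  linarith

lemma sq_le_norm (x : Rn n) : sq x ≤ n * ‖x‖ ^ 2 := by
  have : ∀ i ∈ Finset.univ, x i ^ 2 ≤ ‖x‖ ^ 2 := fun i _ => by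
    have h := norm_le_pi_norm x i
    rw [← sq_abs]
    exact pow_le_pow_left₀ (abs_nonneg _) h 2
  have h := Finset.sum_le_card_nsmul _ _ _ this
  simpa [sq] using h

lemma sq2_le_norm (z : Ph n) : sq2 z ≤ 2 * n * ‖z‖ ^ 2 := by
  have h1 := sq_le_norm z.1
  have h2 := sq_le_norm z.2
  have h3 : ‖z.1‖ ^ 2 ≤ ‖z‖ ^ 2 := pow_le_pow_left₀ (norm_nonneg _) (norm_fst_le z) 2
  have h4 : ‖z.2‖ ^ 2 ≤ ‖z‖ ^ 2 := pow_le_pow_left₀ (norm_nonneg _) (norm_snd_le z) 2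
  have hn : (0 : ℝ) ≤ n := Nat.cast_nonneg n
  have := mul_le_mul_of_nonneg_left h3 hn
  have := mul_le_mul_of_nonneg_left h4 hn
  simp only [sq2]
  linarith

/-- Peetre inequality -/
lemma peetre {s : ℝ} (hs : 0 ≤ s) (u v : Ph n) :
    (1 + sq2 u) ^ (-(s / 2)) ≤
      (2 * (1 + 2 * n) : ℝ) ^ (s / 2) * (1 + sq2 v) ^ (-(s / 2)) * (1 + ‖u - v‖) ^ ⌈s⌉₊ := by
  have hu := sq2_nonneg u
  have hv := sq2_nonneg v
  have hd0 := norm_nonneg (u - v)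
  have hn : (0 : ℝ) ≤ n := Nat.cast_nonneg n
  have h1 : 1 + sq2 v ≤ 2 * (1 + 2 * n) * (1 + ‖u - v‖) ^ 2 * (1 + sq2 u) := by
    have a := sq2_add_le u (v - u)
    rw [add_sub_cancel] at a
    have b := sq2_le_norm (v - u)
    rw [norm_sub_rev] at b
    have c : 0 ≤ (n : ℝ) * ‖u - v‖ := by positivity
    have d : 1 + 2 * n * ‖u - v‖ ^ 2 ≤ (1 + 2 * n) * (1 + ‖u - v‖) ^ 2 := by nlinarith
    have e : 1 ≤ (1 + 2 * n) * (1 + ‖u - v‖) ^ 2 := by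
      have : 0 ≤ 2 * n * ‖u - v‖ ^ 2 := by positivity
      linarith
    nlinarith
  have h2 := Real.rpow_le_rpow (by positivity) h1 (div_nonneg hs zero_le_two)
  rw [Real.mul_rpow (by positivity) (by positivity), Real.mul_rpow (by positivity) (by positivity)]
    at h2
  have h3 : ((1 + ‖u - v‖) ^ 2) ^ (s / 2) ≤ (1 + ‖u - v‖) ^ ⌈s⌉₊ := by
    rw [← Real.rpow_natCast, ← Real.rpow_mul (by positivity), ← Real.rpow_natCast]
    refine Real.rpow_le_rpow_of_exponent_le (by linarith) ?_
    have := Nat.le_ceil s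
    push_cast
    linarith
  rw [Real.rpow_neg (by positivity), Real.rpow_neg (by positivity)]
  have pu : 0 < (1 + sq2 u) ^ (s / 2) := by positivity
  have pv : 0 < (1 + sq2 v) ^ (s / 2) := by positivity
  have pk : 0 ≤ (2 * (1 + 2 * n) : ℝ) ^ (s / 2) := by positivity
  rw [inv_le_iff_one_le_mul₀ pu]
  have h4 : (1 + sq2 v) ^ (s / 2) ≤
      (2 * (1 + 2 * n) : ℝ) ^ (s / 2) * (1 + ‖u - v‖) ^ ⌈s⌉₊ * (1 + sq2 u) ^ (s / 2) := by
    refine h2.trans ?_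
    gcongr
  calc (1 : ℝ) = (1 + sq2 v) ^ (s / 2) * ((1 + sq2 v) ^ (s / 2))⁻¹ := (mul_inv_cancel₀ pv.ne').symm
    _ ≤ _ := mul_le_mul_of_nonneg_right h4 (inv_nonneg.mpr pv.le)
    _ = _ := by ring

lemma tame_lip {χ : Ph n → Ph n} (hχ : IsTameSymplecto χ) :
    ∃ L : ℝ, 0 ≤ L ∧ ∀ x y, ‖χ x - χ y‖ ≤ L * ‖x - y‖ := by
  obtain ⟨hc, -, -, hb⟩ := hχ
  obtain ⟨C, hC⟩ := hb 1 le_rfl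
  refine ⟨C, (norm_nonneg _).trans (hC 0), fun x y => ?_⟩
  refine Convex.norm_image_sub_le_of_norm_fderiv_le (𝕜 := ℝ) (s := Set.univ)
    (fun z _ => (hc.differentiable (by simp)) z) (fun z _ => ?_) convex_univ trivial trivial
  have := hC z
  rwa [norm_iteratedFDeriv_one] at this

theorem main_est (χ : Ph n → Ph n) (hχ : IsTameSymplecto χ) (s : ℝ) (hs : 0 ≤ s)
    (g₁ g₂ : SchwartzMap (Rn n) ℂ)
    (α₁ β₁ : ℝ) (hα₁ : 0 < α₁) (hβ₁ : 0 < β₁)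
    (hframe₁ : IsFrame (fun k => T1 (latt α₁ β₁ k) ⇑g₁)) {C₁ : ℝ} (hC₁ : 0 < C₁) :
    ∃ C₂ : ℝ, 0 < C₂ ∧ ∀ (r : ℝ) (_ : 0 < r) (u : ℝˣ)
      (A : SchwartzMap (Rn n) ℂ →L[ℂ] Distrib n),
      (∀ k l, ‖A (dilS u (Tz (latt α₁ β₁ k) g₁)) (cj (dilS u (Tz (latt α₁ β₁ l) g₁)))‖ ≤
        C₁ * (1 + sq2 (r⁻¹ • (r • latt α₁ β₁ l - χ (r • latt α₁ β₁ k)))) ^ (-(s / 2))) →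
      ∀ z w, ‖A (dilS u (Tz z g₂)) (cj (dilS u (Tz w g₂)))‖ ≤
        C₂ * (1 + sq2 (r⁻¹ • (r • w - χ (r • z)))) ^ (-(s / 2)) := by
  obtain ⟨a, ha, hab⟩ := gabor_exp hα₁ hβ₁ g₁ g₂ hframe₁
  obtain ⟨L, hL0, hL⟩ := tame_lip hχ
  obtain ⟨C, hC0, hC⟩ := hab ⌈s⌉₊
  set N := ⌈s⌉₊
  set K : ℝ := (2 * (1 + 2 * n) : ℝ) ^ (s / 2) with hK
  have hK0 : 0 ≤ K := by positivity
  refine ⟨C₁ * K * (1 + L) ^ N * C * C + 1, by positivity, fun r hr u A hA z w => ?_⟩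
  set F : ℝ := (1 + sq2 (r⁻¹ • (r • w - χ (r • z)))) ^ (-(s / 2)) with hF
  have hF0 : 0 ≤ F := Real.rpow_nonneg (add_nonneg zero_le_one (sq2_nonneg _)) _
  have key : ∀ k l, ‖A (dilS u (Tz (latt α₁ β₁ k) g₁)) (cj (dilS u (Tz (latt α₁ β₁ l) g₁)))‖ ≤
      C₁ * K * (1 + L) ^ N * F * (1 + ‖latt α₁ β₁ k - z‖) ^ N * (1 + ‖latt α₁ β₁ l - w‖) ^ N := by
    intro k l
    refine (hA k l).trans ?_
    have h1 := peetre hs (r⁻¹ • (r • latt α₁ β₁ l - χ (r • latt α₁ β₁ k)))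
      (r⁻¹ • (r • w - χ (r • z)))
    rw [← hK, ← hF] at h1
    have h2 : 1 + ‖r⁻¹ • (r • latt α₁ β₁ l - χ (r • latt α₁ β₁ k)) - r⁻¹ • (r • w - χ (r • z))‖ ≤
        (1 + L) * (1 + ‖latt α₁ β₁ k - z‖) * (1 + ‖latt α₁ β₁ l - w‖) := by
      have e : r⁻¹ • (r • latt α₁ β₁ l - χ (r • latt α₁ β₁ k)) - r⁻¹ • (r • w - χ (r • z)) =
          (latt α₁ β₁ l - w) - r⁻¹ • (χ (r • latt α₁ β₁ k) - χ (r • z)) := by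
        simp only [smul_sub, smul_smul, inv_mul_cancel₀ hr.ne', one_smul]
        abel
      rw [e]
      have b1 := norm_sub_le (latt α₁ β₁ l - w) (r⁻¹ • (χ (r • latt α₁ β₁ k) - χ (r • z)))
      have b2 : ‖r⁻¹ • (χ (r • latt α₁ β₁ k) - χ (r • z))‖ ≤ L * ‖latt α₁ β₁ k - z‖ := by
        have := hL (r • latt α₁ β₁ k) (r • z)
        rw [← smul_sub, norm_smul, Real.norm_of_nonneg hr.le] at this
        rw [norm_smul, norm_inv, Real.norm_of_nonneg hr.le, inv_mul_le_iff₀ hr]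
        linarith
      have c1 := norm_nonneg (latt α₁ β₁ l - w)
      have c2 := norm_nonneg (latt α₁ β₁ k - z)
      have c3 := mul_nonneg c1 c2
      have c4 := mul_nonneg hL0 c1
      have c5 := mul_nonneg hL0 c3
      nlinarith
    have h3 := pow_le_pow_left₀ (by positivity) h2 N
    calc _ ≤ C₁ * (K * F * ((1 + L) * (1 + ‖latt α₁ β₁ k - z‖) * (1 + ‖latt α₁ β₁ l - w‖)) ^ N) := by
          refine mul_le_mul_of_nonneg_left (h1.trans ?_) hC₁.le
          exact mul_le_mul_of_nonneg_left h3 (by positivity)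
      _ = _ := by rw [mul_pow, mul_pow]; ring
  have step1 : ∀ k, ‖A (dilS u (Tz (latt α₁ β₁ k) g₁)) (cj (dilS u (Tz w g₂)))‖ ≤
      C₁ * K * (1 + L) ^ N * F * (1 + ‖latt α₁ β₁ k - z‖) ^ N * C := by
    intro k
    have h1 := ((ha w).mapL (dilS u)).map (cj : SchwartzMap (Rn n) ℂ →L[ℝ] _) cj.continuous
    have h2 := h1.mapL (A (dilS u (Tz (latt α₁ β₁ k) g₁)))
    refine norm_le_of_hasSum h2 (by positivity) (hC w).1 (hC w).2 fun l => ?_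
    have e : cj (dilS u (a w l • Tz (latt α₁ β₁ l) g₁)) =
        conj (a w l) • cj (dilS u (Tz (latt α₁ β₁ l) g₁)) := by
      ext t
      rw [map_smul, cj_apply, SchwartzMap.smul_apply, SchwartzMap.smul_apply, cj_apply,
        smul_eq_mul, smul_eq_mul, map_mul]
    simp only [Function.comp]
    rw [e, map_smul, norm_smul, RCLike.norm_conj]
    have := mul_le_mul_of_nonneg_left (key k l) (norm_nonneg (a w l))
    linarith
  have step2 : ‖A (dilS u (Tz z g₂)) (cj (dilS u (Tz w g₂)))‖ ≤
      C₁ * K * (1 + L) ^ N * F * C * C := by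
    have h1 := ((ha z).mapL (dilS u)).mapL A
    let ev : Distrib n →+ ℂ :=
      { toFun := fun T => T (cj (dilS u (Tz w g₂))), map_zero' := rfl, map_add' := fun _ _ => rfl }
    have h2 := h1.map ev (continuous_eval_const (F := Distrib n) (cj (dilS u (Tz w g₂))))
    refine norm_le_of_hasSum h2 (by positivity) (hC z).1 (hC z).2 fun k => ?_
    have e : (ev ∘ fun b => A (dilS u (a z b • Tz (latt α₁ β₁ b) g₁))) k =
        a z k • A (dilS u (Tz (latt α₁ β₁ k) g₁)) (cj (dilS u (Tz w g₂))) := by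
      simp only [Function.comp, map_smul]
      rfl
    rw [e, norm_smul]
    have := mul_le_mul_of_nonneg_left (step1 k) (norm_nonneg (a z k))
    linarith
  refine step2.trans ?_
  nlinarith

/-- the class FIO_ħ(χ,s) does not depend on the chosen ħ-Gabor frame: if the
uniform discrete ħ-Gabor matrix estimate holds for the frame generated by g₁ and
Λ₁ = α₁ℤⁿ×β₁ℤⁿ, it also holds (with a possibly different constant) for the frame generated
by g₂ and Λ₂ = α₂ℤⁿ×β₂ℤⁿ. -/
theorem stmt10 (n : ℕ) (χ : Ph n → Ph n) (hχ : IsTameSymplecto χ) (s : ℝ) (hs : 0 ≤ s)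
    (g₁ g₂ : SchwartzMap (Rn n) ℂ)
    (α₁ β₁ α₂ β₂ : ℝ) (hα₁ : 0 < α₁) (hβ₁ : 0 < β₁) (hα₂ : 0 < α₂) (hβ₂ : 0 < β₂)
    (hframe₁ : IsFrame (fun k => T1 (latt α₁ β₁ k) ⇑g₁))
    (hframe₂ : IsFrame (fun k => T1 (latt α₂ β₂ k) ⇑g₂))
    (A : ℝ → (SchwartzMap (Rn n) ℂ →L[ℂ] Distrib n))
    (hA : ∃ C₁ : ℝ, 0 < C₁ ∧
      ∀ hbar : ℝ, 0 < hbar → hbar ≤ 1 →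
      ∀ k k' : (Fin n → ℤ) × (Fin n → ℤ), ∀ Φ Ψ : SchwartzMap (Rn n) ℂ,
      (∀ t, Φ t = WH hbar (Real.sqrt (2 * Real.pi * hbar) • latt α₁ β₁ k)
        (gh (2 * Real.pi * hbar) ⇑g₁) t) →
      (∀ t, Ψ t = conj (WH hbar (Real.sqrt (2 * Real.pi * hbar) • latt α₁ β₁ k')
        (gh (2 * Real.pi * hbar) ⇑g₁) t)) →
      ‖A hbar Φ Ψ‖ ≤
        C₁ * (1 + sq2 ((Real.sqrt (2 * Real.pi * hbar))⁻¹ •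
          (Real.sqrt (2 * Real.pi * hbar) • latt α₁ β₁ k' -
            χ (Real.sqrt (2 * Real.pi * hbar) • latt α₁ β₁ k)))) ^ (-(s / 2))) :
    ∃ C₂ : ℝ, 0 < C₂ ∧
      ∀ hbar : ℝ, 0 < hbar → hbar ≤ 1 →
      ∀ k k' : (Fin n → ℤ) × (Fin n → ℤ), ∀ Φ Ψ : SchwartzMap (Rn n) ℂ,
      (∀ t, Φ t = WH hbar (Real.sqrt (2 * Real.pi * hbar) • latt α₂ β₂ k)
        (gh (2 * Real.pi * hbar) ⇑g₂) t) →
      (∀ t, Ψ t = conj (WH hbar (Real.sqrt (2 * Real.pi * hbar) • latt α₂ β₂ k')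
        (gh (2 * Real.pi * hbar) ⇑g₂) t)) →
      ‖A hbar Φ Ψ‖ ≤
        C₂ * (1 + sq2 ((Real.sqrt (2 * Real.pi * hbar))⁻¹ •
          (Real.sqrt (2 * Real.pi * hbar) • latt α₂ β₂ k' -
            χ (Real.sqrt (2 * Real.pi * hbar) • latt α₂ β₂ k)))) ^ (-(s / 2)) := by
  obtain ⟨C₁, hC₁, hA⟩ := hA
  obtain ⟨C₂, hC₂, H⟩ := main_est χ hχ s hs g₁ g₂ α₁ β₁ hα₁ hβ₁ hframe₁ hC₁
  refine ⟨C₂, hC₂, fun hbar hb hb1 k k' Φ Ψ hΦ hΨ => ?_⟩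
  have hr : 0 < Real.sqrt (2 * Real.pi * hbar) := Real.sqrt_pos.mpr (by positivity)
  let u : ℝˣ := Units.mk0 (Real.sqrt (2 * Real.pi * hbar))⁻¹ (inv_ne_zero hr.ne')
  have hu : (u : ℝ) = (Real.sqrt (2 * Real.pi * hbar))⁻¹ := rfl
  have eΦ : Φ = dilS u (Tz (latt α₂ β₂ k) g₂) := by
    ext t
    rw [hΦ, WH_scale hb u hu]
  have eΨ : Ψ = cj (dilS u (Tz (latt α₂ β₂ k') g₂)) := by
    ext t
    rw [hΨ, WH_scale hb u hu, cj_apply]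
  rw [eΦ, eΨ]
  refine H _ hr u (A hbar) (fun k l => ?_) _ _
  refine hA hbar hb hb1 k l _ _ (fun t => ?_) (fun t => ?_)
  · rw [WH_scale hb u hu]
  · rw [WH_scale hb u hu, cj_apply]

end SC
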